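/- arXiv:2512.06188 — 2 statements merged into one kernel-verified Lean document; each statement's English description precedes it below -/
import Mathlib

section
/- Let μ be a finite nonnegative Radon measure on a bounded domain Ω ⊆ ℝⁿ and S ⊆ Ω a compact set whose Hausdorff dimension exceeds d, where d < n - α and α ∈ (1, n). Then there exist a point p ∈ S, a set E that is α-thin at p, a constant C, and δ > 0 such that R^{α,Ω}_μ(x) ≤ C |x-p|^{-(n-α-d)} for all x ∈ B_δ(p) \ E. -/
open MeasureTheory Metric Set Filter
open scoped ENNReal NNReal Topology

noncomputable section

/-- Euclidean n-space. -/
abbrev Euc (n : ℕ) := EuclideanSpace ℝ (Fin n)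

/-- The Riesz potential `R^{α,Ω}_μ(x)`: for `α < n` it is `∫_Ω |x-y|^{α-n} dμ(y)`,
and for `α = n` (the remaining case `α ≤ n`) it is `∫_Ω log (D/|x-y|) dμ(y)`
where `D = diam Ω`. -/
def rieszPotential (n : ℕ) (α : ℝ) (Ω : Set (Euc n)) (μ : Measure (Euc n)) (x : Euc n) :
    ℝ≥0∞ :=
  if α < n then ∫⁻ y in Ω, ENNReal.ofReal (‖x - y‖ ^ (α - (n : ℝ))) ∂μ
  else ∫⁻ y in Ω, ENNReal.ofReal (Real.log (Metric.diam Ω / ‖x - y‖)) ∂μ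

/-- The Riesz capacity
`C^α_L(E,Ω) = inf { μ(Ω) : μ ≥ 0 a Radon measure on Ω, R^{α,Ω}_μ ≥ 1 on E }`. -/
def rieszCap (n : ℕ) (α : ℝ) (E Ω : Set (Euc n)) : ℝ≥0∞ :=
  sInf {c | ∃ μ : Measure (Euc n),
    (∀ x ∈ E, 1 ≤ rieszPotential n α Ω μ x) ∧ c = μ Ω}

/-- The closed dyadic annulus `ω^δ_i(p) = {x : |x-p| ∈ [2^{-i} δ, 2^{-i+1} δ]}`. -/
def dyadicAnnulus (n : ℕ) (δ : ℝ) (i : ℕ) (p : Euc n) : Set (Euc n) :=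
  {x | ‖x - p‖ ∈ Set.Icc ((2 : ℝ) ^ (-(i : ℤ)) * δ) ((2 : ℝ) ^ (-(i : ℤ) + 1) * δ)}

/-- The open dyadic annulus `Ω^δ_i(p) = {x : |x-p| ∈ (2^{-i-1} δ, 2^{-i+2} δ)}`. -/
def dyadicAnnulusO (n : ℕ) (δ : ℝ) (i : ℕ) (p : Euc n) : Set (Euc n) :=
  {x | ‖x - p‖ ∈ Set.Ioo ((2 : ℝ) ^ (-(i : ℤ) - 1) * δ) ((2 : ℝ) ^ (-(i : ℤ) + 2) * δ)}

/-- `E` is `α`-thin at `p` with respect to the Riesz capacity: for `α ∈ (1, n)` this means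
`Σ_{i≥1} C^α_L(E ∩ ω^δ_i(p), Ω^δ_i(p)) / C^α_L(∂B_{2^{-i}δ}(p), B_{2^{-i+1}δ}(p)) < ∞`
for some small `δ > 0`; for `α = n` it means
`Σ_{i≥1} i · C^n_L(E ∩ ω^δ_i(p), Ω^δ_i(p)) < ∞` for some small `δ > 0`. -/
def RieszThinAt (n : ℕ) (α : ℝ) (E : Set (Euc n)) (p : Euc n) : Prop :=
  if α < n then
    ∃ δ > (0 : ℝ), ∑' i : ℕ,
      rieszCap n α (E ∩ dyadicAnnulus n δ (i + 1) p) (dyadicAnnulusO n δ (i + 1) p) /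
        rieszCap n α (Metric.sphere p ((2 : ℝ) ^ (-(i : ℤ) - 1) * δ))
          (Metric.ball p ((2 : ℝ) ^ (-(i : ℤ)) * δ)) < ⊤
  else
    ∃ δ > (0 : ℝ), ∑' i : ℕ,
      ((i + 1 : ℕ) : ℝ≥0∞) *
        rieszCap n n (E ∩ dyadicAnnulus n δ (i + 1) p) (dyadicAnnulusO n δ (i + 1) p) < ⊤

/-- A set of nonzero `d`-dimensional Hausdorff measure contains a point at which a given finite
measure has finite upper `d`-density. -/
theorem exists_forall_measure_closedBall_le {X : Type*} [MetricSpace X]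
    [SecondCountableTopology X] [MeasurableSpace X] [BorelSpace X] (μ : Measure X)
    [IsFiniteMeasure μ] {s : Set X} {d : ℝ} (hd : 0 < d)
    (hs : Measure.hausdorffMeasure d s ≠ 0) :
    ∃ p ∈ s, ∃ C : ℕ, ∀ r > 0, μ (closedBall p r) ≤ C * ENNReal.ofReal r ^ d := by
  by_contra! H
  apply hs
  have key (k : ℕ) : ∃ u : Set X, ∃ r : X → ℝ, u.Countable ∧ (s ⊆ ⋃ x ∈ u, closedBall x (5 * r x)) ∧
      (u.PairwiseDisjoint fun x => closedBall x (r x)) ∧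
      ∀ x ∈ u, 0 < r x ∧ ENNReal.ofReal (r x) ^ d ≤ μ (closedBall x (r x)) / (k + 1 : ℕ) := by
    have H' : ∀ p : X, ∃ r : ℝ, p ∈ s → 0 < r ∧
        ENNReal.ofReal r ^ d ≤ μ (closedBall p r) / (k + 1 : ℕ) := by
      intro p
      by_cases hp : p ∈ s
      · obtain ⟨r, hr, h⟩ := H p hp (k + 1)
        refine ⟨r, fun _ => ⟨hr, ?_⟩⟩
        rw [ENNReal.le_div_iff_mul_le (by simp) (by simp), mul_comm]
        exact h.le
      · exact ⟨0, fun h => (hp h).elim⟩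
    choose r hr using H'
    have hbd : ∀ p ∈ s, r p ≤ (μ univ ^ d⁻¹).toReal := by
      intro p hp
      rw [← ENNReal.ofReal_le_iff_le_toReal (by simp [hd.le]), ← ENNReal.rpow_le_rpow_iff hd,
        ENNReal.rpow_inv_rpow hd.ne']
      refine (hr p hp).2.trans (ENNReal.div_le_of_le_mul ?_)
      refine (measure_mono (subset_univ _)).trans (le_mul_of_one_le_right (by simp) ?_)
      exact_mod_cast Nat.le_add_left 1 k
    obtain ⟨u, hus, hud, hcov⟩ := Vitali.exists_disjoint_subfamily_covering_enlargement_closedBall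
      s id r _ hbd 5 (by norm_num)
    refine ⟨u, r, ?_, ?_, hud, fun x hx => hr x (hus hx)⟩
    · refine hud.countable_of_nonempty_interior fun x hx => ⟨x, ?_⟩
      exact ball_subset_interior_closedBall (mem_ball_self (hr x (hus hx)).1)
    · intro x hx
      obtain ⟨b, hb, h⟩ := hcov x hx
      exact mem_biUnion hb (h (mem_closedBall_self (hr x hx).1.le))
  choose u r huc hcov hdisj hr using key
  have : ∀ k, Countable (u k) := fun k => (huc k).to_subtype
  have hlim : Tendsto (fun k : ℕ => (10 : ℝ≥0∞) ^ d * (μ univ / (k + 1 : ℕ))) atTop (𝓝 0) := by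
    have h1 : Tendsto (fun k : ℕ => ((k : ℕ) : ℝ≥0∞)⁻¹) atTop (𝓝 0) :=
      ENNReal.tendsto_inv_nat_nhds_zero
    have h2 := (tendsto_add_atTop_iff_nat 1).2 h1
    have h3 := ENNReal.Tendsto.const_mul (a := 10 ^ d * μ univ) h2
      (Or.inr (ENNReal.mul_ne_top (by simp) (by simp)))
    simpa [div_eq_mul_inv, mul_assoc] using h3
  have hdiam (k : ℕ) (x : u k) : ediam (closedBall (x : X) (5 * r k x)) ^ d ≤
      10 ^ d * (μ (closedBall (x : X) (r k x)) / (k + 1 : ℕ)) := by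
    have hx := hr k x x.2
    have : ediam (closedBall (x : X) (5 * r k x)) ≤ 10 * ENNReal.ofReal (r k x) := by
      rw [← Metric.closedEBall_ofReal (by linarith)]
      refine ediam_closedEBall_le.trans ?_
      rw [ENNReal.ofReal_mul (by norm_num), ← mul_assoc]
      norm_num
    grw [this, ENNReal.mul_rpow_of_nonneg _ _ hd.le, hx.2]
  refine le_antisymm ?_ zero_le
  refine (Measure.hausdorffMeasure_le_liminf_tsum d s (l := atTop)
    (fun k : ℕ => ((10 : ℝ≥0∞) ^ d * (μ univ / (k + 1 : ℕ))) ^ d⁻¹) ?_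
    (fun k (x : u k) => closedBall (x : X) (5 * r k x)) ?_ ?_).trans ?_
  · have := hlim.ennrpow_const d⁻¹
    rwa [ENNReal.zero_rpow_of_pos (by positivity)] at this
  · refine Eventually.of_forall fun k x => ?_
    rw [ENNReal.le_rpow_inv_iff hd]
    refine (hdiam k x).trans ?_
    gcongr
    exact subset_univ _
  · refine Eventually.of_forall fun k x hx => ?_
    simpa using hcov k hx
  · rw [← hlim.liminf_eq]
    refine liminf_le_liminf (Eventually.of_forall fun k => ?_)
    refine (ENNReal.tsum_le_tsum (hdiam k)).trans ?_
    rw [ENNReal.tsum_mul_left]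
    simp only [div_eq_mul_inv]
    rw [ENNReal.tsum_mul_right]
    gcongr
    refine (tsum_meas_le_meas_iUnion_of_disjoint μ (fun _ => measurableSet_closedBall) ?_).trans
      (measure_mono (subset_univ _))
    exact (hdisj k).subtype

theorem tsum_ofReal_rpow_neg_mul_ofReal_rpow_lt_top {b c d d' : ℝ} (hb : 0 < b) (hc : 0 < c)
    (hdd' : d < d') :
    ∑' i : ℕ, ENNReal.ofReal (b * (1 / 2) ^ i) ^ (-d) * ENNReal.ofReal (c * (1 / 2) ^ i) ^ d' < ∞ := by
  have h (i : ℕ) : ENNReal.ofReal (b * (1 / 2) ^ i) ^ (-d) * ENNReal.ofReal (c * (1 / 2) ^ i) ^ d' =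
      ENNReal.ofReal (b ^ (-d) * c ^ d' * ((1 / 2 : ℝ) ^ (d' - d)) ^ i) := by
    rw [ENNReal.ofReal_rpow_of_pos (by positivity), ENNReal.ofReal_rpow_of_pos (by positivity),
      ← ENNReal.ofReal_mul (by positivity), Real.mul_rpow hb.le (by positivity),
      Real.mul_rpow hc.le (by positivity), ← Real.rpow_natCast, ← Real.rpow_natCast,
      ← Real.rpow_mul (by norm_num), ← Real.rpow_mul (by norm_num), ← Real.rpow_mul (by norm_num),
      sub_mul, mul_comm d', mul_comm d, sub_eq_add_neg, Real.rpow_add (by norm_num), mul_neg]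
    congr 1
    ring
  simp_rw [h]
  refine lt_top_iff_ne_top.2 (Summable.tsum_ofReal_ne_top (Summable.mul_left _ ?_))
  refine summable_geometric_of_lt_one (by positivity) ?_
  exact Real.rpow_lt_one (by norm_num) (by norm_num) (by linarith)

theorem lintegral_enorm_sub_rpow_neg_lt_top {E : Type*} [NormedAddCommGroup E] [MeasurableSpace E]
    [BorelSpace E] (μ : Measure E) [IsFiniteMeasure μ] {p : E} {d d' : ℝ} {C : ℝ≥0∞} (hC : C ≠ ∞)
    (hd : 0 ≤ d) (hdd' : d < d')
    (hμ : ∀ r > 0, μ (closedBall p r) ≤ C * ENNReal.ofReal r ^ d') :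
    ∫⁻ y, ‖y - p‖ₑ ^ (-d) ∂μ < ∞ := by
  have hpt (y : E) : ‖y - p‖ₑ ^ (-d) ≤ 1 + ∑' i : ℕ, ENNReal.ofReal (1 / 2 * (1 / 2) ^ i) ^ (-d) *
      (closedBall p ((1 / 2) ^ i)).indicator 1 y := by
    rcases eq_or_ne y p with rfl | hyp
    · suffices ∑' i : ℕ, ENNReal.ofReal (1 / 2 * (1 / 2) ^ i) ^ (-d) *
          (closedBall y ((1 / 2) ^ i)).indicator 1 y = ∞ by
        rw [this, add_top]
        exact le_top
      refine top_unique ?_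
      rw [← ENNReal.tsum_const_eq_top_of_ne_zero (α := ℕ) one_ne_zero]
      refine ENNReal.tsum_le_tsum fun i => ?_
      rw [indicator_of_mem (mem_closedBall_self (by positivity)), Pi.one_apply, mul_one,
        ENNReal.rpow_neg, ENNReal.one_le_inv]
      refine ENNReal.rpow_le_one ?_ hd
      rw [ENNReal.ofReal_le_one, ← pow_succ']
      exact pow_le_one₀ (by norm_num) (by norm_num)
    · have hpos : 0 < ‖y - p‖ := norm_pos_iff.2 (sub_ne_zero.2 hyp)
      rcases le_total 1 ‖y - p‖ with h1 | h1
      · refine le_trans ?_ le_self_add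
        rw [ENNReal.rpow_neg, ENNReal.inv_le_one]
        rw [← ENNReal.one_rpow d, ← ofReal_norm]
        exact ENNReal.rpow_le_rpow (ENNReal.one_le_ofReal.2 h1) hd
      · obtain ⟨i, hi, hi'⟩ := exists_nat_pow_near_of_lt_one hpos h1 (y := (1 / 2 : ℝ))
          (by norm_num) (by norm_num)
        refine le_trans ?_ (le_add_self.trans' (ENNReal.le_tsum i))
        rw [indicator_of_mem (by rwa [mem_closedBall_iff_norm]), Pi.one_apply, mul_one,
          ENNReal.rpow_neg, ENNReal.rpow_neg, ENNReal.inv_le_inv, ← ofReal_norm]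
        gcongr
        rw [← pow_succ']
        exact hi.le
  refine (lintegral_mono hpt).trans_lt ?_
  rw [lintegral_add_left measurable_const, lintegral_tsum fun i =>
    ((measurable_one.indicator measurableSet_closedBall).const_mul _).aemeasurable]
  refine ENNReal.add_lt_top.2 ⟨by simp, lt_of_le_of_lt ?_ (ENNReal.mul_lt_top hC.lt_top
    (tsum_ofReal_rpow_neg_mul_ofReal_rpow_lt_top (b := 1 / 2) (c := 1) (by norm_num) one_pos hdd'))⟩
  rw [← ENNReal.tsum_mul_left]
  refine ENNReal.tsum_le_tsum fun i => ?_
  rw [lintegral_const_mul _ (measurable_one.indicator measurableSet_closedBall),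
    lintegral_indicator_one measurableSet_closedBall, mul_left_comm]
  gcongr
  simpa using hμ ((1 / 2) ^ i) (by positivity)

/-- Potentials of Lebesgue measure on the unit ball are uniformly bounded. -/
theorem exists_lintegral_ball_enorm_sub_rpow_le {W : Type*} [NormedAddCommGroup W]
    [NormedSpace ℝ W] [FiniteDimensional ℝ W] [MeasurableSpace W] [BorelSpace W]
    (ν : Measure W) [ν.IsAddHaarMeasure] {s : ℝ} (hs0 : 0 < s) (hs : s < Module.finrank ℝ W)  :
    ∃ K : ℝ≥0, 0 < K ∧ ∀ z : W, ∫⁻ w in ball 0 1, ‖w - z‖ₑ ^ (-s) ∂ν ≤ K := by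
  have hdim : 1 ≤ Module.finrank ℝ W := by
    exact_mod_cast hs0.trans hs
  have : Nontrivial W := Module.nontrivial_of_finrank_pos (R := ℝ) hdim
  have hK : ∫⁻ w in ball (0 : W) 1, ‖w‖ₑ ^ (-s) ∂ν < ∞ := by
    have hint : IntegrableOn (fun w : W => ‖w‖ ^ (-s)) (ball 0 1) ν := by
      refine integrableOn_ball_of_norm_le_rpow (C := 1) (α := s) hdim hs ?_ ?_
      · refine Eventually.of_forall fun w => ?_
        rw [one_mul, Real.norm_of_nonneg (by positivity)]
      · exact (measurable_norm.pow_const _).aestronglyMeasurable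
    refine lt_of_eq_of_lt (lintegral_congr_ae ?_) hint.2
    refine ae_restrict_of_ae ?_
    filter_upwards [Measure.ae_ne ν 0] with w hw
    rw [← ofReal_norm, ENNReal.ofReal_rpow_of_pos (norm_pos_iff.2 hw),
      Real.enorm_of_nonneg (by positivity)]
  have hv : ν (ball 0 1) < ∞ := measure_ball_lt_top
  refine ⟨(∫⁻ w in ball (0 : W) 1, ‖w‖ₑ ^ (-s) ∂ν + ν (ball 0 1)).toNNReal, ?_, fun z => ?_⟩
  · rw [ENNReal.toNNReal_pos_iff]
    exact ⟨(measure_ball_pos ν 0 one_pos).trans_le le_add_self, ENNReal.add_lt_top.2 ⟨hK, hv⟩⟩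
  · rw [ENNReal.coe_toNNReal (ENNReal.add_lt_top.2 ⟨hK, hv⟩).ne]
    have htr : ∫⁻ w in ball z 1, ‖w - z‖ₑ ^ (-s) ∂ν = ∫⁻ w in ball (0 : W) 1, ‖w‖ₑ ^ (-s) ∂ν := by
      have hpre : (fun w => w - z) ⁻¹' ball 0 1 = ball z 1 := by
        ext w
        simp [dist_eq_norm]
      rw [← hpre]
      exact (measurePreserving_sub_right ν z).setLIntegral_comp_preimage measurableSet_ball
          (f := fun w => ‖w‖ₑ ^ (-s)) (by fun_prop)
    rw [← lintegral_inter_add_sdiff _ (ball 0 1) (measurableSet_ball (x := z) (ε := 1))]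
    refine add_le_add ?_ ?_
    · rw [← htr]
      exact lintegral_mono_set inter_subset_right
    · refine (setLIntegral_mono measurable_const (g := fun _ => 1) fun w hw => ?_).trans ?_
      · rw [ENNReal.rpow_neg, ENNReal.inv_le_one]
        refine ENNReal.one_le_rpow ?_ hs0
        rw [← ofReal_norm, ENNReal.one_le_ofReal]
        simpa [dist_eq_norm] using hw.2
      · simpa using measure_mono sdiff_subset

theorem ofReal_norm_rpow_neg_le {V : Type*} [NormedAddCommGroup V] (v : V) {s : ℝ} (hs : 0 < s) :
    ENNReal.ofReal (‖v‖ ^ (-s)) ≤ ‖v‖ₑ ^ (-s) := by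
  rcases eq_or_ne v 0 with rfl | hv
  · simp [hs]
  · rw [← ofReal_norm, ENNReal.ofReal_rpow_of_pos (norm_pos_iff.2 hv)]

theorem rieszPotential_of_lt {n : ℕ} {α : ℝ} (hα : α < n) (Ω : Set (Euc n)) (μ : Measure (Euc n))
    (x : Euc n) :
    rieszPotential n α Ω μ x = ∫⁻ y in Ω, ENNReal.ofReal (‖x - y‖ ^ (-((n : ℝ) - α))) ∂μ := by
  rw [rieszPotential, if_pos hα, neg_sub]

/-- The Riesz capacity of a sphere of radius `r` is at least a constant times `r ^ (n - α)`. -/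
theorem exists_le_rieszCap_sphere {n : ℕ} {α : ℝ} (hα₁ : 1 < α) (hα₂ : α < n) :
    ∃ c : ℝ≥0, 0 < c ∧ ∀ (p : Euc n) (r : ℝ) (Ω : Set (Euc n)), 0 < r →
      c * ENNReal.ofReal r ^ ((n : ℝ) - α) ≤ rieszCap n α (sphere p r) Ω := by
  obtain ⟨m, rfl⟩ : ∃ m, n = m + 1 := ⟨n - 1, by
    have : 1 < n := by exact_mod_cast hα₁.trans hα₂
    omega⟩
  set s : ℝ := ((m + 1 : ℕ) : ℝ) - α with hs
  have hs0 : 0 < s := by linarith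
  set e : Euc (m + 1) := EuclideanSpace.single 0 1 with he
  have hen : ‖e‖ = 1 := by simp [he]
  set W : Submodule ℝ (Euc (m + 1)) := (ℝ ∙ e)ᗮ with hW
  have : Fact (Module.finrank ℝ (Euc (m + 1)) = m + 1) := ⟨by simp⟩
  have hWdim : Module.finrank ℝ W = m :=
    Submodule.finrank_orthogonal_span_singleton (norm_ne_zero_iff.1 (by simp [hen]))
  obtain ⟨K, hK0, hK⟩ := exists_lintegral_ball_enorm_sub_rpow_le (volume : Measure W) hs0
    (by rw [hWdim, hs]; push_cast; linarith)
  have hvpos : 0 < volume (ball (0 : W) 1) := measure_ball_pos _ _ one_pos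
  have hvfin : volume (ball (0 : W) 1) ≠ ∞ := measure_ball_lt_top.ne
  refine ⟨(volume (ball (0 : W) 1)).toNNReal / K,
    div_pos (ENNReal.toNNReal_pos hvpos.ne' hvfin) hK0, fun p r Ω hr => le_sInf ?_⟩
  rintro _ ⟨μ, hμ, rfl⟩
  rcases eq_or_ne (μ Ω) ∞ with htop | htop
  · simp [htop]
  have : IsFiniteMeasure (μ.restrict Ω) := ⟨by simpa using htop.lt_top⟩
  set G : W → Euc (m + 1) := fun w => p + r • ((w : Euc (m + 1)) + √(1 - ‖w‖ ^ 2) • e) with hG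
  have hGs : ∀ w ∈ ball (0 : W) 1, G w ∈ sphere p r := by
    intro w hw
    have hw1 : ‖w‖ < 1 := by simpa using hw
    have horth : inner ℝ (w : Euc (m + 1)) (√(1 - ‖w‖ ^ 2) • e) = 0 := by
      rw [inner_smul_right, Submodule.mem_orthogonal_singleton_iff_inner_left.1 w.2, mul_zero]
    have h1 : ‖(w : Euc (m + 1)) + √(1 - ‖w‖ ^ 2) • e‖ = 1 := by
      have h2 : ‖(w : Euc (m + 1)) + √(1 - ‖w‖ ^ 2) • e‖ * ‖(w : Euc (m + 1)) + √(1 - ‖w‖ ^ 2) • e‖ =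
          ‖w‖ * ‖w‖ + ‖√(1 - ‖w‖ ^ 2) • e‖ * ‖√(1 - ‖w‖ ^ 2) • e‖ :=
        norm_add_sq_eq_norm_sq_add_norm_sq_of_inner_eq_zero _ _ horth
      have h3 : √(1 - ‖w‖ ^ 2) * √(1 - ‖w‖ ^ 2) = 1 - ‖w‖ ^ 2 :=
        Real.mul_self_sqrt (by nlinarith [norm_nonneg w])
      rw [norm_smul, hen, mul_one, Real.norm_of_nonneg (Real.sqrt_nonneg _), h3] at h2
      rw [← sq_eq_sq₀ (norm_nonneg _) zero_le_one]
      nlinarith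
    rw [mem_sphere_iff_norm, hG, add_sub_cancel_left, norm_smul, h1, mul_one,
      Real.norm_of_nonneg hr.le]
  set P := W.orthogonalProjectionOnto with hP
  have hPG (w : W) (y : Euc (m + 1)) : ‖r • (w - P (r⁻¹ • (y - p)))‖ ≤ ‖G w - y‖ := by
    have hPe : P e = 0 := Submodule.orthogonalProjectionOnto_orthogonalComplement_singleton_eq_zero e
    have hPw : P w = w := Submodule.orthogonalProjectionOnto_mem_subspace_eq_self w
    have : r • (w - P (r⁻¹ • (y - p))) = P (G w - y) := by
      simp only [hG, map_sub, map_add, map_smul, hPe, smul_sub, smul_add, smul_zero, add_zero,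
        smul_inv_smul₀ hr.ne', hPw]
      abel
    rw [this]
    exact W.norm_orthogonalProjectionOnto_apply_le _
  have hpt (w : W) (y : Euc (m + 1)) : ENNReal.ofReal (‖G w - y‖ ^ (-s)) ≤
      ENNReal.ofReal r ^ (-s) * ‖w - P (r⁻¹ • (y - p))‖ₑ ^ (-s) := by
    refine (ofReal_norm_rpow_neg_le _ hs0).trans ?_
    rw [← ENNReal.mul_rpow_of_ne_top ENNReal.ofReal_ne_top enorm_ne_top,
      ← Real.enorm_of_nonneg hr.le, ← enorm_smul, ENNReal.rpow_neg, ENNReal.rpow_neg,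
      ENNReal.inv_le_inv]
    exact ENNReal.rpow_le_rpow (enorm_le_iff_norm_le.2 (hPG w y)) hs0.le
  have hmain : volume (ball (0 : W) 1) ≤ ENNReal.ofReal r ^ (-s) * K * μ Ω := calc
    volume (ball (0 : W) 1) = ∫⁻ w in ball (0 : W) 1, 1 := by simp
    _ ≤ ∫⁻ w in ball (0 : W) 1, ∫⁻ y in Ω,
        ENNReal.ofReal r ^ (-s) * ‖w - P (r⁻¹ • (y - p))‖ₑ ^ (-s) ∂μ := by
      refine setLIntegral_mono' measurableSet_ball fun w hw => ?_
      refine (hμ _ (hGs w hw)).trans ?_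
      rw [rieszPotential_of_lt hα₂]
      exact lintegral_mono fun y => hpt w y
    _ = ∫⁻ y in Ω, ∫⁻ w in ball (0 : W) 1,
        ENNReal.ofReal r ^ (-s) * ‖w - P (r⁻¹ • (y - p))‖ₑ ^ (-s) ∂volume ∂μ := by
      refine lintegral_lintegral_swap ?_
      refine Measurable.aemeasurable ?_
      have : Measurable fun y : Euc (m + 1) => P (r⁻¹ • (y - p)) :=
        (P.continuous.comp (by fun_prop)).measurable
      have h2 : Measurable fun q : W × Euc (m + 1) => q.1 - P (r⁻¹ • (q.2 - p)) :=
        measurable_fst.sub (this.comp measurable_snd)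
      exact (h2.enorm.pow_const _).const_mul _
    _ ≤ ∫⁻ y in Ω, ENNReal.ofReal r ^ (-s) * K ∂μ := by
      refine lintegral_mono fun y => ?_
      rw [lintegral_const_mul _ (by fun_prop)]
      gcongr
      exact hK _
    _ = _ := by simp
  have hrs : ENNReal.ofReal r ^ s ≠ 0 := by simp [hr]
  have hrs' : ENNReal.ofReal r ^ s ≠ ∞ := by simp [hs0.le]
  rw [ENNReal.coe_div hK0.ne', ENNReal.coe_toNNReal hvfin]
  calc _ ≤ ENNReal.ofReal r ^ (-s) * K * μ Ω / K * ENNReal.ofReal r ^ s := by gcongr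
    _ = (ENNReal.ofReal r ^ s)⁻¹ * ENNReal.ofReal r ^ s * (K / K) * μ Ω := by
      rw [ENNReal.rpow_neg]
      simp only [div_eq_mul_inv]
      ring
    _ = μ Ω := by
      rw [ENNReal.inv_mul_cancel hrs hrs', ENNReal.div_self (by simpa using hK0.ne') (by simp)]
      simp

theorem rieszCap_le_of_forall_le_rieszPotential {n : ℕ} {α : ℝ} (hα : α < n) {E Ω : Set (Euc n)}
    (ν : Measure (Euc n)) {t : ℝ≥0∞} (ht0 : t ≠ 0) (ht : t ≠ ∞)
    (h : ∀ x ∈ E, t ≤ rieszPotential n α Ω ν x) : rieszCap n α E Ω ≤ t⁻¹ * ν Ω := by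
  refine sInf_le ⟨t⁻¹ • ν, fun x hx => ?_, by simp⟩
  have := h x hx
  rw [rieszPotential_of_lt hα] at this ⊢
  rw [Measure.restrict_smul, lintegral_smul_measure, smul_eq_mul, ← ENNReal.inv_mul_cancel ht0 ht]
  gcongr

/-- Kernel bound for `x` in an annulus around `p` and `y` outside the enlarged annulus. -/
theorem ofReal_norm_sub_rpow_neg_le {V : Type*} [NormedAddCommGroup V] {x y p : V} {ρ d s : ℝ}
    (hρ : 0 < ρ) (hd : 0 ≤ d) (hds : d ≤ s) (hx₁ : ρ ≤ ‖x - p‖) (hx₂ : ‖x - p‖ ≤ 2 * ρ)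
    (hy : ‖y - p‖ ≤ ρ / 2 ∨ 4 * ρ ≤ ‖y - p‖) :
    ENNReal.ofReal (‖x - y‖ ^ (-s)) ≤ 2 ^ s * ENNReal.ofReal ρ ^ (d - s) * ‖y - p‖ₑ ^ (-d) := by
  have h1 : ‖x - p‖ ≤ ‖x - y‖ + ‖y - p‖ := norm_sub_le_norm_sub_add_norm_sub x y p
  have h2 : ‖y - p‖ ≤ ‖x - y‖ + ‖x - p‖ := by
    rw [norm_sub_rev x y]
    exact norm_sub_le_norm_sub_add_norm_sub y x p
  have hm₁ : ρ / 2 ≤ ‖x - y‖ := by rcases hy with hy | hy <;> linarith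
  have hm₂ : ‖y - p‖ / 2 ≤ ‖x - y‖ := by rcases hy with hy | hy <;> linarith
  have hm : 0 < ‖x - y‖ := by linarith
  have hhalf {u : ℝ≥0∞} (hu : u ≠ ∞) (a : ℝ) : (u / 2) ^ a = 2 ^ (-a) * u ^ a := by
    rw [div_eq_mul_inv, ENNReal.mul_rpow_of_ne_top hu (by simp), mul_comm, ENNReal.inv_rpow,
      ENNReal.rpow_neg]
  have e₁ : ENNReal.ofReal ρ / 2 ≤ ENNReal.ofReal ‖x - y‖ := by
    rw [← ENNReal.ofReal_ofNat 2, ← ENNReal.ofReal_div_of_pos two_pos]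
    exact ENNReal.ofReal_le_ofReal hm₁
  have e₂ : ‖y - p‖ₑ / 2 ≤ ENNReal.ofReal ‖x - y‖ := by
    rw [← ofReal_norm, ← ENNReal.ofReal_ofNat 2, ← ENNReal.ofReal_div_of_pos two_pos]
    exact ENNReal.ofReal_le_ofReal hm₂
  have hneg {u v : ℝ≥0∞} {a : ℝ} (huv : u ≤ v) (ha : a ≤ 0) : v ^ a ≤ u ^ a := by
    rw [← neg_neg a, ENNReal.rpow_neg, ENNReal.rpow_neg u, ENNReal.inv_le_inv]
    exact ENNReal.rpow_le_rpow huv (by linarith)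
  calc ENNReal.ofReal (‖x - y‖ ^ (-s))
      = ENNReal.ofReal ‖x - y‖ ^ (d - s) * ENNReal.ofReal ‖x - y‖ ^ (-d) := by
        rw [← ENNReal.rpow_add _ _ (by simpa using hm) ENNReal.ofReal_ne_top,
          ENNReal.ofReal_rpow_of_pos hm]
        congr 2
        ring
    _ ≤ (ENNReal.ofReal ρ / 2) ^ (d - s) * (‖y - p‖ₑ / 2) ^ (-d) := by
        gcongr ?_ * ?_
        · exact hneg e₁ (by linarith)
        · exact hneg e₂ (by linarith)
    _ = _ := by
        rw [hhalf ENNReal.ofReal_ne_top, hhalf enorm_ne_top, mul_mul_mul_comm,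
          ← ENNReal.rpow_add _ _ (by simp) (by simp), ← mul_assoc]
        congr 3
        ring

/-- let `μ` be a finite nonnegative Radon measure on a bounded domain
`Ω ⊆ ℝⁿ` and `S ⊆ Ω` compact of Hausdorff dimension `> d`, where `d < n - α` and
`α ∈ (1, n)`. Then there are `p ∈ S`, a set `E` that is `α`-thin at `p`, a constant
`C` and `δ > 0` with `R^{α,Ω}_μ(x) ≤ C |x-p|^{-(n-α-d)}` for all `x ∈ B_δ(p) \ E`. -/
theorem riesz_potential_upper_bound_on_large_set (n : ℕ) (α d : ℝ)
    (hα₁ : 1 < α) (hα₂ : α < n) (hd : d < (n : ℝ) - α)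
    (Ω : Set (Euc n)) (hΩo : IsOpen Ω) (hΩb : Bornology.IsBounded Ω)
    (hΩc : IsConnected Ω)
    (μ : Measure (Euc n)) [IsFiniteMeasure μ]
    (S : Set (Euc n)) (hS : IsCompact S) (hSΩ : S ⊆ Ω)
    (hdim : ENNReal.ofReal d < dimH S) :
    ∃ p ∈ S, ∃ E : Set (Euc n), RieszThinAt n α E p ∧
      ∃ C : ℝ, ∃ δ > (0 : ℝ), ∀ x ∈ Metric.ball p δ \ E,
        rieszPotential n α Ω μ x ≤ ENNReal.ofReal (C / ‖x - p‖ ^ ((n : ℝ) - α - d)) := by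
  set s : ℝ := (n : ℝ) - α with hs
  have hs0 : 0 < s := by linarith
  obtain ⟨d', hdd', hd'⟩ := ENNReal.lt_iff_exists_nnreal_btwn.1 hdim
  set d₀ : ℝ := max d 0 with hd₀
  have hd₀0 : 0 ≤ d₀ := le_max_right _ _
  have hd₀s : d₀ < s := max_lt hd hs0
  have hd₀d' : d₀ < d' := by
    rw [hd₀, ← Real.coe_toNNReal', NNReal.coe_lt_coe]
    exact ENNReal.coe_lt_coe.1 hdd'
  have hHaus : Measure.hausdorffMeasure (d' : ℝ) S ≠ 0 := by
    simp [hausdorffMeasure_of_lt_dimH hd']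
  obtain ⟨p, hpS, A, hA⟩ :=
    exists_forall_measure_closedBall_le μ (hd₀0.trans_lt hd₀d') hHaus
  have hM := lintegral_enorm_sub_rpow_neg_lt_top μ (ENNReal.natCast_ne_top A) hd₀0 hd₀d' hA
  set M := ∫⁻ y, ‖y - p‖ₑ ^ (-d₀) ∂μ with hMdef
  obtain ⟨c, hc0, hc⟩ := exists_le_rieszCap_sphere hα₁ hα₂
  set ρ : ℕ → ℝ := fun i => (1 / 2) ^ (i + 1) with hρ
  have hρ0 (i : ℕ) : 0 < ρ i := by positivity
  have hρz (i : ℕ) : (2 : ℝ) ^ (-((i + 1 : ℕ) : ℤ)) = ρ i := by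
    simp only [hρ, zpow_neg, zpow_natCast, one_div, inv_pow]
  set F : ℕ → Set (Euc n) := fun i => dyadicAnnulusO n 1 (i + 1) p with hF
  have hann (i : ℕ) (x : Euc n) :
      x ∈ dyadicAnnulus n 1 (i + 1) p ↔ ρ i ≤ ‖x - p‖ ∧ ‖x - p‖ ≤ 2 * ρ i := by
    rw [dyadicAnnulus, mem_ofPred_eq, mem_Icc, zpow_add₀ two_ne_zero, hρz, zpow_one, mul_one,
      mul_one, mul_comm 2]
  have hannO (i : ℕ) (y : Euc n) : y ∈ F i ↔ ρ i / 2 < ‖y - p‖ ∧ ‖y - p‖ < 4 * ρ i := by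
    simp only [hF, dyadicAnnulusO]
    rw [mem_ofPred_eq, mem_Ioo, zpow_sub₀ two_ne_zero, zpow_add₀ two_ne_zero,
      hρz, zpow_one, mul_one, mul_one, mul_comm 4]
    norm_num
  have hFm (i : ℕ) : MeasurableSet (F i) := by
    have : Measurable fun y : Euc n => ‖y - p‖ := by fun_prop
    exact this measurableSet_Ioo
  set lev : ℕ → ℝ≥0∞ := fun i => ENNReal.ofReal (ρ i) ^ (d₀ - s) with hlev
  set E : Set (Euc n) := {x | ∀ i, x ∈ dyadicAnnulus n 1 (i + 1) p →
    lev i ≤ rieszPotential n α (F i) (μ.restrict Ω) x} with hE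
  have hρpos (i : ℕ) : ENNReal.ofReal (ρ i) ≠ 0 := by simpa using hρ0 i
  refine ⟨p, hpS, E, ?_, 2 ^ (s - d₀) * (1 + 2 ^ s * M.toReal), 1, one_pos, ?_⟩
  · rw [RieszThinAt, if_pos hα₂]
    refine ⟨1, one_pos, lt_of_le_of_lt ?_ (ENNReal.mul_lt_top
      (ENNReal.mul_lt_top (ENNReal.inv_lt_top.2 (ENNReal.coe_pos.2 hc0)) (ENNReal.natCast_lt_top A))
      (tsum_ofReal_rpow_neg_mul_ofReal_rpow_lt_top (b := 1 / 2) (c := 2) (by norm_num) two_pos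
        hd₀d'))⟩
    rw [← ENNReal.tsum_mul_left]
    refine ENNReal.tsum_le_tsum fun i => ?_
    have hnum : rieszCap n α (E ∩ dyadicAnnulus n 1 (i + 1) p) (F i) ≤
        (lev i)⁻¹ * (A * ENNReal.ofReal (4 * ρ i) ^ (d' : ℝ)) := by
      refine (rieszCap_le_of_forall_le_rieszPotential hα₂ (μ.restrict Ω)
        (ENNReal.rpow_pos (pos_iff_ne_zero.2 (hρpos i)) ENNReal.ofReal_ne_top).ne'
        (ENNReal.rpow_ne_top_of_ne_zero (hρpos i) ENNReal.ofReal_ne_top)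
        fun x hx => hx.1 i hx.2).trans ?_
      gcongr
      refine (Measure.restrict_apply_le _ _).trans ((measure_mono fun y hy => ?_).trans
        (hA _ (by linarith [hρ0 i])))
      rw [mem_closedBall_iff_norm]
      exact ((hannO i y).1 hy).2.le
    have hr : (2 : ℝ) ^ (-(i : ℤ) - 1) * 1 = ρ i := by
      rw [mul_one, ← hρz]
      congr 1
      push_cast
      ring
    rw [hr]
    refine (ENNReal.div_le_div hnum (hc p (ρ i) _ (hρ0 i))).trans_eq ?_
    have h4 : 4 * ρ i = 2 * (1 / 2) ^ i := by
      simp only [hρ, pow_succ]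
      ring
    have h1 : ρ i = 1 / 2 * (1 / 2) ^ i := by
      simp only [hρ, pow_succ]
      ring
    rw [h4, ← h1, ← hs, hlev, ← ENNReal.rpow_neg, div_eq_mul_inv,
      ENNReal.mul_inv (Or.inr (ENNReal.rpow_ne_top_of_ne_zero (hρpos i) ENNReal.ofReal_ne_top))
        (Or.inl ENNReal.coe_ne_top), ← ENNReal.rpow_neg,
      show -d₀ = -(d₀ - s) + -s by ring, ENNReal.rpow_add _ _ (hρpos i) ENNReal.ofReal_ne_top]
    ring
  · rintro x ⟨hx1, hxE⟩
    simp only [hE, mem_ofPred_eq, not_forall, not_le] at hxE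
    obtain ⟨i, hxi, hlt⟩ := hxE
    obtain ⟨hx₁, hx₂⟩ := (hann i x).1 hxi
    have hxp : 0 < ‖x - p‖ := (hρ0 i).trans_le hx₁
    have hxp1 : ‖x - p‖ < 1 := by rwa [mem_ball_iff_norm] at hx1
    have hout : ∫⁻ y in (F i)ᶜ, ENNReal.ofReal (‖x - y‖ ^ (-s)) ∂(μ.restrict Ω) ≤
        2 ^ s * lev i * M := calc
      _ ≤ ∫⁻ y in (F i)ᶜ, 2 ^ s * lev i * ‖y - p‖ₑ ^ (-d₀) ∂(μ.restrict Ω) := by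
        refine setLIntegral_mono' (hFm i).compl fun y hy => ?_
        refine ofReal_norm_sub_rpow_neg_le (hρ0 i) hd₀0 hd₀s.le hx₁ hx₂ ?_
        by_contra! h
        exact hy ((hannO i y).2 h)
      _ = 2 ^ s * lev i * ∫⁻ y in (F i)ᶜ, ‖y - p‖ₑ ^ (-d₀) ∂(μ.restrict Ω) :=
        lintegral_const_mul _ (by fun_prop)
      _ ≤ 2 ^ s * lev i * M := by
        gcongr
        exact lintegral_mono' (Measure.restrict_le_self.trans Measure.restrict_le_self) le_rfl
    have hlevle : lev i ≤ ENNReal.ofReal (2 ^ (s - d₀) / ‖x - p‖ ^ (s - d)) := by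
      simp only [hlev]
      rw [ENNReal.ofReal_rpow_of_pos (hρ0 i)]
      refine ENNReal.ofReal_le_ofReal ?_
      calc ρ i ^ (d₀ - s) ≤ (‖x - p‖ / 2) ^ (d₀ - s) :=
            Real.rpow_le_rpow_of_nonpos (by positivity) (by linarith) (by linarith)
        _ = 2 ^ (s - d₀) / ‖x - p‖ ^ (s - d₀) := by
            rw [Real.div_rpow hxp.le zero_le_two, ← neg_sub s, Real.rpow_neg hxp.le,
              Real.rpow_neg zero_le_two]
            field_simp
        _ ≤ 2 ^ (s - d₀) / ‖x - p‖ ^ (s - d) := by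
            refine div_le_div_of_nonneg_left (by positivity) (by positivity) ?_
            exact Real.rpow_le_rpow_of_exponent_ge hxp hxp1.le (by linarith [le_max_left d 0])
    rw [rieszPotential_of_lt hα₂, ← hs, ← lintegral_add_compl _ (hFm i)]
    rw [rieszPotential_of_lt hα₂, ← hs] at hlt
    calc _ ≤ lev i + 2 ^ s * lev i * M := add_le_add hlt.le hout
      _ = lev i * (1 + 2 ^ s * M) := by ring
      _ ≤ ENNReal.ofReal (2 ^ (s - d₀) / ‖x - p‖ ^ (s - d)) * (1 + 2 ^ s * M) := by gcongr
      _ = ENNReal.ofReal (2 ^ (s - d₀) / ‖x - p‖ ^ (s - d)) *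
          ENNReal.ofReal (1 + 2 ^ s * M.toReal) := by
        rw [ENNReal.ofReal_add zero_le_one (by positivity), ENNReal.ofReal_one,
          ENNReal.ofReal_mul (by positivity), ENNReal.ofReal_toReal hM.ne,
          ← ENNReal.ofReal_rpow_of_pos two_pos, ENNReal.ofReal_ofNat]
      _ = _ := by
        rw [← ENNReal.ofReal_mul (by positivity)]
        congr 1
        ring
end
end

section
/- Let μ be a nonnegative finite Radon measure on Ω ⊆ ℝⁿ with B(x₀, 3r₀) ⊆ Ω and p ∈ (1, n). Then there exists a set E, p-thin for singular behavior at x₀, such that lim_{x→x₀, x∉E} |x-x₀|^{(n-p)/(p-1)} W^μ_{1,p}(x, r₀) = ((p-1)/(n-p)) μ({x₀})^{1/(p-1)}. -/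
open MeasureTheory Metric Set Filter
open scoped ENNReal NNReal Topology

noncomputable section

/-- The Wolff potential `W^μ_{1,p}(x, r) = ∫₀^r (μ(B(x,t))/t^{n-p})^{1/(p-1)} dt/t`. -/
def wolffPotential (n : ℕ) (p : ℝ) (μ : Measure (Euc n)) (x : Euc n) (r : ℝ) : ℝ≥0∞ :=
  ∫⁻ t in Set.Ioo (0 : ℝ) r,
    (μ (Metric.ball x t) / ENNReal.ofReal (t ^ ((n : ℝ) - p))) ^ (1 / (p - 1)) *
      ENNReal.ofReal t⁻¹

/-- The variational `p`-capacity of a compact set `K` inside `Ω`: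
`cap_p(K,Ω) = inf {∫_Ω |∇u|^p : u ∈ C₀^∞(Ω), u ≥ 1 on K}`. -/
def varCapCompact (n : ℕ) (p : ℝ) (K Ω : Set (Euc n)) : ℝ≥0∞ :=
  sInf {c | ∃ u : Euc n → ℝ, ContDiff ℝ (⊤ : ℕ∞) u ∧ HasCompactSupport u ∧ tsupport u ⊆ Ω ∧
    (∀ x ∈ K, 1 ≤ u x) ∧ c = ∫⁻ x in Ω, ENNReal.ofReal (‖fderiv ℝ u x‖ ^ p)}

/-- The variational `p`-capacity of an arbitrary set `E ⊆ Ω`, extended in the standard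
way: `cap_p(E,Ω) = inf_{open G ⊇ E, G ⊆ Ω} sup_{compact K ⊆ G} cap_p(K,Ω)`. -/
def varCap (n : ℕ) (p : ℝ) (E Ω : Set (Euc n)) : ℝ≥0∞ :=
  ⨅ G ∈ {G : Set (Euc n) | IsOpen G ∧ E ⊆ G ∧ G ⊆ Ω},
    ⨆ K ∈ {K : Set (Euc n) | IsCompact K ∧ K ⊆ G}, varCapCompact n p K Ω

/-- The dyadic annulus `ω_i(x₀) = {x : 2^{-i} ≤ |x-x₀| ≤ 2^{-i+1}}`. -/
def wAnn (n : ℕ) (i : ℕ) (x₀ : Euc n) : Set (Euc n) :=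
  {x | ‖x - x₀‖ ∈ Set.Icc ((2 : ℝ) ^ (-(i : ℤ))) ((2 : ℝ) ^ (-(i : ℤ) + 1))}

/-- The dyadic annulus `Ω_i(x₀) = {x : 2^{-i-1} ≤ |x-x₀| ≤ 2^{-i+2}}`. -/
def wAnnO (n : ℕ) (i : ℕ) (x₀ : Euc n) : Set (Euc n) :=
  {x | ‖x - x₀‖ ∈ Set.Icc ((2 : ℝ) ^ (-(i : ℤ) - 1)) ((2 : ℝ) ^ (-(i : ℤ) + 2))}

/-- `E` is `p`-thin for singular behavior at `x₀`: for `p ∈ (1, n)`,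
`Σ_{i≥1} cap_p(E ∩ ω_i(x₀), Ω_i(x₀)) / cap_p(∂B(x₀,2^{-i}), B(x₀,2^{-i+1})) < ∞`;
for `p = n`, `Σ_{i≥1} i^{n-1} cap_n(E ∩ ω_i(x₀), Ω_i(x₀)) < ∞`. -/
def pThinAt (n : ℕ) (p : ℝ) (E : Set (Euc n)) (x₀ : Euc n) : Prop :=
  if p < n then
    ∑' i : ℕ,
      varCap n p (E ∩ wAnn n (i + 1) x₀) (wAnnO n (i + 1) x₀) /
        varCap n p (Metric.sphere x₀ ((2 : ℝ) ^ (-(i : ℤ) - 1)))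
          (Metric.ball x₀ ((2 : ℝ) ^ (-(i : ℤ)))) < ⊤
  else
    ∑' i : ℕ, ((i + 1 : ℕ) : ℝ≥0∞) ^ ((n : ℝ) - 1) *
      varCap n n (E ∩ wAnn n (i + 1) x₀) (wAnnO n (i + 1) x₀) < ⊤

/-! ### Inequalities for powers of finite sums -/

lemma ENNReal.add_rpow_le_rpow_add_mul {p : ℝ} (hp : 1 < p) (a b : ℝ≥0∞) :
    (a + b) ^ p ≤ a ^ p + ENNReal.ofReal p * (b * (a + b) ^ (p - 1)) := by
  have hp0 : 0 < p := by linarith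
  have hp1 : 0 < p - 1 := by linarith
  by_cases ha : a = ⊤
  · simp [ha, ENNReal.top_rpow_of_pos hp0]
  by_cases hb : b = ⊤
  · have : ENNReal.ofReal p ≠ 0 := by simpa using hp0
    simp [hb, ENNReal.top_rpow_of_pos hp0, ENNReal.top_rpow_of_pos hp1, ENNReal.mul_top this]
  lift a to ℝ≥0 using ha
  lift b to ℝ≥0 using hb
  have key : ((a : ℝ) + b) ^ p ≤ (a : ℝ) ^ p + p * (b * ((a : ℝ) + b) ^ (p - 1)) := by
    rcases eq_or_lt_of_le (add_nonneg a.coe_nonneg b.coe_nonneg) with h | h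
    · rw [← h, Real.zero_rpow hp0.ne']
      have := a.coe_nonneg
      have := b.coe_nonneg
      positivity
    set s : ℝ := (a : ℝ) + b with hs
    have hbs : (b : ℝ) / s ≤ 1 := by
      rw [div_le_one h, hs]; linarith [a.coe_nonneg]
    have h1 := one_add_mul_self_le_rpow_one_add (s := -((b : ℝ) / s)) (by linarith) hp.le
    have h2 : 1 + -((b : ℝ) / s) = a / s := by
      rw [hs] at h ⊢; field_simp; ring
    rw [h2, Real.div_rpow a.coe_nonneg h.le] at h1
    have h3 : s ^ p = s * s ^ (p - 1) := by
      rw [← Real.rpow_one_add' h.le (by linarith)]; congr 1; ring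
    have hsp : 0 < s ^ p := Real.rpow_pos_of_pos h p
    rw [le_div_iff₀ hsp] at h1
    have h4 : (1 + p * -((b : ℝ) / s)) * s ^ p = s ^ p - p * (b * s ^ (p - 1)) := by
      rw [h3]; field_simp; ring
    linarith
  have e1 : (a : ℝ≥0∞) = ENNReal.ofReal a := by simp
  have e2 : (b : ℝ≥0∞) = ENNReal.ofReal b := by simp
  have ha := a.coe_nonneg
  have hb := b.coe_nonneg
  rw [e1, e2, ← ENNReal.ofReal_add ha hb, ENNReal.ofReal_rpow_of_nonneg (by positivity) hp0.le,
    ENNReal.ofReal_rpow_of_nonneg (by positivity) hp0.le,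
    ENNReal.ofReal_rpow_of_nonneg (by positivity) hp1.le, ← ENNReal.ofReal_mul hb,
    ← ENNReal.ofReal_mul hp0.le, ← ENNReal.ofReal_add (by positivity) (by positivity)]
  exact ENNReal.ofReal_le_ofReal key

lemma ENNReal.sum_rpow_le_sum_mul_tail {p : ℝ} (hp : 1 < p) (N : ℕ) (g : ℕ → ℝ≥0∞) :
    (∑ i ∈ Finset.range N, g i) ^ p ≤
      ENNReal.ofReal p * ∑ i ∈ Finset.range N,
        g i * (∑ k ∈ Finset.range (N - i), g (i + k)) ^ (p - 1) := by
  induction N generalizing g with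
  | zero => simp [show 0 < p by linarith]
  | succ N ih =>
    rw [Finset.sum_range_succ' (fun i => g i * _)]
    have h := ENNReal.add_rpow_le_rpow_add_mul hp (∑ i ∈ Finset.range N, g (i + 1)) (g 0)
    rw [← Finset.sum_range_succ'] at h
    refine h.trans ?_
    rw [mul_add]
    refine add_le_add ((ih fun i => g (i + 1)).trans_eq ?_) (by simp)
    congr 1
    refine Finset.sum_congr rfl fun i _ => ?_
    rw [Nat.add_sub_add_right]
    simp only [add_right_comm]

lemma ENNReal.exists_sum_rpow_le_weighted {q : ℝ} (hq : 0 < q) :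
    ∃ C : ℝ≥0∞, C ≠ ⊤ ∧ ∀ (N : ℕ) (c : ℕ → ℝ≥0∞),
      (∑ k ∈ Finset.range N, c k) ^ q ≤
        C * ∑ k ∈ Finset.range N, (2 : ℝ≥0∞) ^ ((k : ℝ) / 2) * c k ^ q := by
  set θ : ℝ≥0∞ := (2 : ℝ≥0∞) ^ (-(1 / (2 * q))) with hθ
  have hθ1 : θ < 1 := ENNReal.rpow_lt_one_of_one_lt_of_neg (by norm_num) (by
    have : 0 < 1 / (2 * q) := by positivity
    linarith)
  refine ⟨((1 - θ)⁻¹) ^ q, ?_, fun N c => ?_⟩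
  · refine ENNReal.rpow_ne_top_of_nonneg hq.le ?_
    rw [ENNReal.inv_ne_top]
    exact (tsub_pos_of_lt hθ1).ne'
  set X := ∑ k ∈ Finset.range N, (2 : ℝ≥0∞) ^ ((k : ℝ) / 2) * c k ^ q with hX
  have h1 : ∀ k ∈ Finset.range N, c k ≤ θ ^ k * X ^ (1 / q) := by
    intro k hk
    have h2 : (2 : ℝ≥0∞) ^ ((k : ℝ) / 2) * c k ^ q ≤ X :=
      Finset.single_le_sum (f := fun k : ℕ => (2 : ℝ≥0∞) ^ ((k : ℝ) / 2) * c k ^ q)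
        (fun _ _ => zero_le) hk
    have h3 := ENNReal.rpow_le_rpow h2 (z := 1 / q) (by positivity)
    rw [ENNReal.mul_rpow_of_nonneg _ _ (by positivity), ← ENNReal.rpow_mul, ← ENNReal.rpow_mul,
      mul_one_div_cancel hq.ne', ENNReal.rpow_one] at h3
    calc c k = θ ^ k * (2 ^ ((k : ℝ) / 2 * (1 / q)) * c k) := by
          rw [← mul_assoc, hθ, ← ENNReal.rpow_natCast, ← ENNReal.rpow_mul,
            ← ENNReal.rpow_add _ _ (by norm_num) (by norm_num)]
          rw [show -(1 / (2 * q)) * (k : ℝ) + (k : ℝ) / 2 * (1 / q) = 0 by field_simp; ring]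
          simp
      _ ≤ _ := by gcongr
  calc (∑ k ∈ Finset.range N, c k) ^ q
      ≤ ((1 - θ)⁻¹ * X ^ (1 / q)) ^ q := by
        refine ENNReal.rpow_le_rpow ((Finset.sum_le_sum h1).trans ?_) hq.le
        rw [← Finset.sum_mul, ← ENNReal.tsum_geometric]
        gcongr
        exact ENNReal.sum_le_tsum _
    _ = _ := by
        rw [ENNReal.mul_rpow_of_nonneg _ _ hq.le, ← ENNReal.rpow_mul, one_div_mul_cancel hq.ne',
          ENNReal.rpow_one]

/-! ### Mollification at a given scale -/

lemma exists_mollification (n : ℕ) : ∃ C : ℝ, 0 ≤ C ∧ ∀ ρ : ℝ, 0 < ρ → ∀ B : Euc n → ℝ,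
    Measurable B → (∀ x, 0 ≤ B x) → (∃ M, ∀ x, B x ≤ M) →
    ∃ h : Euc n → ℝ, ContDiff ℝ (⊤ : ℕ∞) h ∧
      (∀ x c, (∀ y ∈ ball x ρ, c ≤ B y) → c ≤ h x) ∧
      (∀ x c, (∀ y ∈ ball x ρ, B y ≤ c) → h x ≤ c) ∧
      (∀ x c, (∀ y ∈ ball x ρ, B y ≤ c) → ‖fderiv ℝ h x‖ ≤ C * c / ρ) := by
  let φ : ContDiffBump (0 : Euc n) := ⟨1 / 2, 1, by norm_num, by norm_num⟩
  set g : Euc n → ℝ := φ.normed volume with hg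
  have hgs : ContDiff ℝ (⊤ : ℕ∞) g := φ.contDiff_normed
  have hgc : HasCompactSupport g := φ.hasCompactSupport_normed
  have hgi : Integrable g := φ.integrable_normed
  have hg0 : ∀ x, 0 ≤ g x := φ.nonneg_normed
  have hgsupp : ∀ z, z ∉ ball (0 : Euc n) 1 → g z = 0 := by
    intro z hz
    have : z ∉ Function.support g := by
      rw [hg, φ.support_normed_eq]; exact hz
    simpa using this
  have hdg : Continuous (fderiv ℝ g) := hgs.continuous_fderiv (by simp)
  have hdgc : HasCompactSupport (fderiv ℝ g) := hgc.fderiv ℝ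
  have hdgi : Integrable (fun z => ‖fderiv ℝ g z‖) :=
    (hdg.integrable_of_hasCompactSupport hdgc).norm
  have hdgsupp : ∀ z, z ∉ ball (0 : Euc n) 1 → fderiv ℝ g z = 0 := by
    intro z hz
    by_cases hz' : ‖z‖ = 1
    · have hmin : IsLocalMin g z := by
        refine Filter.Eventually.of_forall fun y => ?_
        rw [hgsupp z hz]; exact hg0 y
      exact hmin.fderiv_eq_zero
    · have : z ∉ tsupport g := by
        rw [hg, φ.tsupport_normed_eq]
        intro h
        simp only [mem_closedBall, dist_zero_right, mem_ball, not_lt] at h hz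
        exact hz' (le_antisymm h hz)
      exact image_eq_zero_of_notMem_tsupport
        (fun h => this (tsupport_fderiv_subset ℝ h))
  refine ⟨∫ z, ‖fderiv ℝ g z‖, integral_nonneg fun _ => norm_nonneg _, ?_⟩
  rintro ρ hρ B hB hB0 ⟨M, hM⟩
  set B' : Euc n → ℝ := fun y => B (ρ • y) with hB'
  have hB'm : Measurable B' := hB.comp (measurable_const_smul ρ)
  have hB'l : LocallyIntegrable B' := by
    refine (locallyIntegrable_const (M : ℝ)).mono hB'm.aestronglyMeasurable ?_
    refine Filter.Eventually.of_forall fun y => ?_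
    rw [Real.norm_of_nonneg (hB0 _), Real.norm_of_nonneg ((hB0 0).trans (hM 0))]
    exact hM _
  set L := ContinuousLinearMap.lsmul ℝ ℝ (E := ℝ) with hL
  set G : Euc n → ℝ := convolution B' g L volume with hG
  have hGs : ContDiff ℝ (⊤ : ℕ∞) G := hgc.contDiff_convolution_right L hB'l hgs
  have hGx : ∀ x, G x = ∫ t, B' t * g (x - t) := fun x => rfl
  have hintegral : ∀ x, Integrable fun t => B' t * g (x - t) := by
    intro x
    refine (hgi.comp_sub_left x).bdd_mul (c := M) hB'm.aestronglyMeasurable ?_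
    exact Filter.Eventually.of_forall fun y => by
      rw [Real.norm_of_nonneg (hB0 _)]; exact hM _
  have hone : ∀ x, ∫ t, g (x - t) = 1 := by
    intro x
    rw [integral_sub_left_eq_self g volume x]
    exact φ.integral_normed
  have hball : ∀ x t : Euc n, ρ⁻¹ • x - t ∈ ball (0 : Euc n) 1 → ρ • t ∈ ball x ρ := by
    intro x t h
    simp only [mem_ball, dist_zero_right] at h ⊢
    rw [dist_comm, dist_eq_norm]
    have : x - ρ • t = ρ • (ρ⁻¹ • x - t) := by
      rw [smul_sub, smul_smul, mul_inv_cancel₀ hρ.ne', one_smul]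
    rw [this, norm_smul, Real.norm_of_nonneg hρ.le]
    nlinarith
  refine ⟨fun x => G (ρ⁻¹ • x), hGs.comp (contDiff_const_smul _), ?_, ?_, ?_⟩
  · intro x c hc
    beta_reduce
    rw [hGx, ← mul_one c, ← hone (ρ⁻¹ • x), ← integral_const_mul]
    refine integral_mono ((hgi.comp_sub_left _).const_mul c) (hintegral _) fun t => ?_
    by_cases ht : ρ⁻¹ • x - t ∈ ball (0 : Euc n) 1
    · exact mul_le_mul_of_nonneg_right (hc _ (hball x t ht)) (hg0 _)
    · simp [hgsupp _ ht]
  · intro x c hc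
    beta_reduce
    rw [hGx, ← mul_one c, ← hone (ρ⁻¹ • x), ← integral_const_mul]
    refine integral_mono (hintegral _) ((hgi.comp_sub_left _).const_mul c) fun t => ?_
    by_cases ht : ρ⁻¹ • x - t ∈ ball (0 : Euc n) 1
    · exact mul_le_mul_of_nonneg_right (hc _ (hball x t ht)) (hg0 _)
    · simp [hgsupp _ ht]
  · intro x c hc
    have hd := hgc.hasFDerivAt_convolution_right L hB'l (hgs.of_le (by simp)) (ρ⁻¹ • x)
    have hcomp : HasFDerivAt (fun x : Euc n => G (ρ⁻¹ • x))
        ((convolution B' (fderiv ℝ g) (L.precompR (Euc n)) volume (ρ⁻¹ • x)).comp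
          (ρ⁻¹ • ContinuousLinearMap.id ℝ (Euc n))) x :=
      HasFDerivAt.comp x hd ((ρ⁻¹ • ContinuousLinearMap.id ℝ (Euc n)).hasFDerivAt)
    rw [hcomp.fderiv, ContinuousLinearMap.comp_smul, norm_smul, ContinuousLinearMap.comp_id,
      norm_inv, Real.norm_of_nonneg hρ.le, div_eq_inv_mul]
    refine mul_le_mul_of_nonneg_left ?_ (inv_nonneg.2 hρ.le)
    rw [convolution]
    rw [← integral_sub_left_eq_self (fun z => ‖fderiv ℝ g z‖) volume (ρ⁻¹ • x),
      ← integral_mul_const]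
    refine norm_integral_le_of_norm_le ((hdgi.comp_sub_left (ρ⁻¹ • x)).mul_const c) ?_
    refine Filter.Eventually.of_forall fun t => ?_
    have : L.precompR (Euc n) (B' t) (fderiv ℝ g (ρ⁻¹ • x - t)) =
        B' t • fderiv ℝ g (ρ⁻¹ • x - t) := by
      ext v
      simp [hL, ContinuousLinearMap.precompR_apply]
    rw [this, norm_smul, Real.norm_of_nonneg (hB0 _), mul_comm]
    by_cases ht : ρ⁻¹ • x - t ∈ ball (0 : Euc n) 1
    · exact mul_le_mul_of_nonneg_left (hc _ (hball x t ht)) (norm_nonneg _)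
    · simp [hdgsupp _ ht]

/-! ### The density in the Wolff potential and its truncation -/

lemma lowerSemicontinuous_measure_ball {X : Type*} [PseudoMetricSpace X] [MeasurableSpace X]
    (m : Measure X) (t : ℝ) : LowerSemicontinuous fun x => m (ball x t) := by
  intro x c hc
  have hU : ball x t = ⋃ k : ℕ, ball x (t - 1 / ((k : ℝ) + 1)) := by
    ext y
    simp only [mem_ball, mem_iUnion]
    refine ⟨fun h => ?_, fun ⟨k, hk⟩ => ?_⟩
    · obtain ⟨k, hk⟩ := exists_nat_one_div_lt (sub_pos.2 h)
      exact ⟨k, by linarith⟩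
    · have : 0 < 1 / ((k : ℝ) + 1) := by positivity
      linarith
  have hmono : Monotone fun k : ℕ => ball x (t - 1 / ((k : ℝ) + 1)) := by
    intro k l hkl
    refine ball_subset_ball (sub_le_sub_left ?_ _)
    have : (k : ℝ) ≤ l := by exact_mod_cast hkl
    exact one_div_le_one_div_of_le (by positivity) (by linarith)
  change c < m (ball x t) at hc
  rw [hU, hmono.measure_iUnion] at hc
  obtain ⟨k, hk⟩ := lt_iSup_iff.1 hc
  filter_upwards [ball_mem_nhds x (show 0 < 1 / ((k : ℝ) + 1) by positivity)] with y hy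
  refine hk.trans_le (measure_mono (ball_subset_ball' ?_))
  rw [mem_ball, dist_comm] at hy
  linarith

/-- The quantity `(μ(B(x,t))/t^{n-p})^{1/(p-1)}` integrated in the Wolff potential. -/
def wolffDensity (n : ℕ) (p : ℝ) (m : Measure (Euc n)) (t : ℝ) (x : Euc n) : ℝ≥0∞ :=
  (m (ball x t) / ENNReal.ofReal (t ^ ((n : ℝ) - p))) ^ (1 / (p - 1))

/-- The Wolff density truncated at height `2`. -/
def truncDensity (n : ℕ) (p : ℝ) (m : Measure (Euc n)) (t : ℝ) (x : Euc n) : ℝ≥0∞ :=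
  min 2 (wolffDensity n p m t x)

/-- The loss incurred by the Wolff density when the radius is doubled. -/
def doublingConst (n : ℕ) (p : ℝ) : ℝ := 2 ^ (((n : ℝ) - p) / (p - 1))

section Density

variable {n : ℕ} {p : ℝ} {m : Measure (Euc n)}

lemma doublingConst_pos : 0 < doublingConst n p := Real.rpow_pos_of_pos two_pos _

lemma one_le_doublingConst (hp₁ : 1 < p) (hp₂ : p < n) : 1 ≤ doublingConst n p :=
  Real.one_le_rpow one_le_two (div_nonneg (by linarith) (by linarith))

lemma wolffDensity_le (hp₁ : 1 < p) (hp₂ : p < n) {s t : ℝ} {x y : Euc n} (ht : 0 < t)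
    (hs : 0 < s) (hst : s ≤ 2 * t) (h : ball y t ⊆ ball x s) :
    wolffDensity n p m t y ≤ ENNReal.ofReal (doublingConst n p) * wolffDensity n p m s x := by
  have hα : 0 ≤ 1 / (p - 1) := one_div_nonneg.2 (by linarith)
  have h2 : (0 : ℝ) < 2 ^ ((n : ℝ) - p) := Real.rpow_pos_of_pos two_pos _
  have hle : s ^ ((n : ℝ) - p) ≤ 2 ^ ((n : ℝ) - p) * t ^ ((n : ℝ) - p) := by
    rw [← Real.mul_rpow two_pos.le ht.le]
    exact Real.rpow_le_rpow hs.le hst (by linarith)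
  have hsp : 0 < s ^ ((n : ℝ) - p) := Real.rpow_pos_of_pos hs _
  have htp : 0 < t ^ ((n : ℝ) - p) := Real.rpow_pos_of_pos ht _
  have key : m (ball y t) / ENNReal.ofReal (t ^ ((n : ℝ) - p)) ≤
      ENNReal.ofReal (2 ^ ((n : ℝ) - p)) * (m (ball x s) / ENNReal.ofReal (s ^ ((n : ℝ) - p))) := by
    rw [div_eq_mul_inv, div_eq_mul_inv, mul_left_comm, ← ENNReal.ofReal_inv_of_pos hsp,
      ← ENNReal.ofReal_inv_of_pos htp, ← ENNReal.ofReal_mul h2.le]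
    refine mul_le_mul' (measure_mono h) (ENNReal.ofReal_le_ofReal ?_)
    rw [← div_eq_mul_inv, le_div_iff₀ hsp, inv_mul_le_iff₀ htp, mul_comm]
    exact hle
  refine (ENNReal.rpow_le_rpow key hα).trans_eq ?_
  rw [ENNReal.mul_rpow_of_nonneg _ _ hα, ENNReal.ofReal_rpow_of_pos h2,
    ← Real.rpow_mul two_pos.le, mul_one_div, doublingConst, wolffDensity]

lemma truncDensity_le (hp₁ : 1 < p) (hp₂ : p < n) {s t : ℝ} {x y : Euc n} (ht : 0 < t)
    (hs : 0 < s) (hst : s ≤ 2 * t) (h : ball y t ⊆ ball x s) :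
    truncDensity n p m t y ≤ ENNReal.ofReal (doublingConst n p) * truncDensity n p m s x := by
  have h1 : 1 ≤ ENNReal.ofReal (doublingConst n p) :=
    ENNReal.one_le_ofReal.2 (one_le_doublingConst hp₁ hp₂)
  rw [truncDensity, truncDensity, mul_min]
  exact min_le_min (le_mul_of_one_le_left' h1) (wolffDensity_le hp₁ hp₂ ht hs hst h)

lemma truncDensity_le_of_dist_le (hp₁ : 1 < p) (hp₂ : p < n) {t : ℝ} {x y : Euc n}
    (ht : 0 < t) (h : dist y x ≤ t) :
    truncDensity n p m t y ≤
      ENNReal.ofReal (doublingConst n p) * truncDensity n p m (2 * t) x :=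
  truncDensity_le hp₁ hp₂ ht (by linarith) le_rfl (ball_subset_ball' (by linarith))

lemma truncDensity_le_two (t : ℝ) (x : Euc n) : truncDensity n p m t x ≤ 2 := min_le_left _ _

lemma truncDensity_ne_top (t : ℝ) (x : Euc n) : truncDensity n p m t x ≠ ⊤ :=
  ((truncDensity_le_two t x).trans_lt (by norm_num)).ne

lemma lowerSemicontinuous_truncDensity (hp₁ : 1 < p) {t : ℝ} (ht : 0 < t) :
    LowerSemicontinuous (truncDensity n p m t) := by
  have hα : 0 ≤ 1 / (p - 1) := one_div_nonneg.2 (by linarith)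
  have hc : ENNReal.ofReal (t ^ ((n : ℝ) - p)) ≠ 0 := by
    simpa using Real.rpow_pos_of_pos ht _
  have hcont : Continuous fun z : ℝ≥0∞ =>
      min 2 ((z / ENNReal.ofReal (t ^ ((n : ℝ) - p))) ^ (1 / (p - 1))) :=
    continuous_const.min (ENNReal.continuous_rpow_const.comp (ENNReal.continuous_div_const _ hc))
  refine hcont.comp_lowerSemicontinuous (lowerSemicontinuous_measure_ball m t) ?_
  intro a b hab
  exact min_le_min le_rfl (ENNReal.rpow_le_rpow (ENNReal.div_le_div_right hab _) hα)

lemma measurable_truncDensity (hp₁ : 1 < p) {t : ℝ} (ht : 0 < t) :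
    Measurable (truncDensity n p m t) :=
  (lowerSemicontinuous_truncDensity hp₁ ht).measurable

lemma truncDensity_rpow_le (hp₁ : 1 < p) {t : ℝ} (ht : 0 < t) (x : Euc n) :
    truncDensity n p m t x ^ (p - 1) ≤ ENNReal.ofReal (t ^ (p - n)) * m (ball x t) := by
  have h0 : 0 < p - 1 := by linarith
  refine (ENNReal.rpow_le_rpow (min_le_right _ _) h0.le).trans_eq ?_
  rw [wolffDensity, ← ENNReal.rpow_mul, one_div_mul_cancel h0.ne', ENNReal.rpow_one, div_eq_mul_inv,
    ← ENNReal.ofReal_inv_of_pos (Real.rpow_pos_of_pos ht _), ← Real.rpow_neg ht.le, mul_comm,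
    neg_sub]

lemma measure_ball_ne_zero_of_truncDensity_ne_zero (hp₁ : 1 < p) {t : ℝ} {x : Euc n}
    (h : truncDensity n p m t x ≠ 0) : m (ball x t) ≠ 0 := by
  intro h0
  have : 0 < 1 / (p - 1) := one_div_pos.2 (by linarith)
  apply h
  rw [truncDensity, wolffDensity, h0, ENNReal.zero_div, ENNReal.zero_rpow_of_pos this]
  simp

end Density

/-! ### A truncated Wolff inequality -/

section Energy

variable {n : ℕ} {p : ℝ}

lemma setLIntegral_mul_measure_ball_le (m : Measure (Euc n)) [IsFiniteMeasure m]
    {D : Set (Euc n)} (hD : MeasurableSet D) {f F : Euc n → ℝ≥0∞} (hf : Measurable f) {t : ℝ}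
    (h : ∀ y, ∀ x ∈ D, dist x y < t → f x ≤ F y) :
    ∫⁻ x in D, f x * m (ball x t) ≤ ∫⁻ y, F y * volume (ball y t) ∂m := by
  set S : Set (Euc n × Euc n) := {z | dist z.2 z.1 < t} with hS
  have hSm : MeasurableSet S := (isOpen_lt (by fun_prop) continuous_const).measurableSet
  have h1 : ∀ x, f x * m (ball x t) = ∫⁻ y, S.indicator (fun z => f z.1) (x, y) ∂m := by
    intro x
    have : (fun y => S.indicator (fun z => f z.1) (x, y)) =
        (ball x t).indicator fun _ => f x := by
      ext y; simp [Set.indicator, hS]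
    rw [this, lintegral_indicator_const measurableSet_ball]
  simp_rw [h1]
  rw [lintegral_lintegral_swap]
  · refine lintegral_mono fun y => ?_
    calc ∫⁻ x in D, S.indicator (fun z => f z.1) (x, y)
        ≤ ∫⁻ x in D, (ball y t).indicator (fun _ => F y) x := by
          refine setLIntegral_mono' hD fun x hx => ?_
          by_cases hxy : dist y x < t
          · rw [dist_comm] at hxy
            have h2 : (x, y) ∈ S := by rw [hS]; simpa [dist_comm] using hxy
            rw [indicator_of_mem h2, indicator_of_mem (by exact hxy)]
            exact h y x hx hxy
          · have h2 : (x, y) ∉ S := by rw [hS]; simpa using hxy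
            rw [indicator_of_notMem h2]
            exact zero_le
      _ ≤ ∫⁻ x, (ball y t).indicator (fun _ => F y) x := setLIntegral_le_lintegral _ _
      _ = _ := by rw [lintegral_indicator_const measurableSet_ball]
  · exact ((hf.comp measurable_fst).indicator hSm).aemeasurable

/-- The set where the sum of the truncated densities over `N` dyadic scales is at most one. -/
def sublevelSet (n : ℕ) (p : ℝ) (m : Measure (Euc n)) (r : ℝ) (N : ℕ) : Set (Euc n) :=
  {x | ∑ j ∈ Finset.range N, truncDensity n p m (r / 2 ^ (j + 4)) x ≤ 1}

lemma measurableSet_sublevelSet (hp₁ : 1 < p) {m : Measure (Euc n)} {r : ℝ} (hr : 0 < r)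
    (N : ℕ) : MeasurableSet (sublevelSet n p m r N) :=
  measurableSet_le
    (Finset.measurable_sum _ fun _ _ => measurable_truncDensity hp₁ (by positivity))
    measurable_const

lemma sum_indicator_thickening_le (hp₁ : 1 < p) (hp₂ : p < n) {m : Measure (Euc n)} {r : ℝ}
    (hr : 0 < r) (N : ℕ) (y : Euc n) :
    ∑ j ∈ Finset.range N, (thickening (r / 2 ^ (j + 2)) (sublevelSet n p m r N)).indicator
      (truncDensity n p m (r / 2 ^ (j + 1))) y ≤ ENNReal.ofReal (doublingConst n p) * 9 := by
  classical
  set D := sublevelSet n p m r N with hD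
  set s := (Finset.range N).filter fun j => y ∈ thickening (r / 2 ^ (j + 2)) D with hs
  have hsum : ∑ j ∈ Finset.range N, (thickening (r / 2 ^ (j + 2)) D).indicator
      (truncDensity n p m (r / 2 ^ (j + 1))) y =
      ∑ j ∈ s, truncDensity n p m (r / 2 ^ (j + 1)) y := by
    rw [hs, Finset.sum_filter]
    rfl
  rw [hsum]
  rcases s.eq_empty_or_nonempty with h | h
  · rw [h, Finset.sum_empty]; exact bot_le
  have hJ := s.max'_mem h
  set J := s.max' h
  obtain ⟨x, hxD, hx⟩ := mem_thickening_iff.1 (Finset.mem_filter.1 hJ).2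
  calc ∑ j ∈ s, truncDensity n p m (r / 2 ^ (j + 1)) y
      ≤ ∑ j ∈ s, ENNReal.ofReal (doublingConst n p) * truncDensity n p m (r / 2 ^ j) x := by
        refine Finset.sum_le_sum fun j hj => ?_
        have hjJ : j ≤ J := s.le_max' j hj
        have := truncDensity_le_of_dist_le (m := m) hp₁ hp₂ (t := r / 2 ^ (j + 1)) (x := x) (y := y)
          (by positivity) (hx.le.trans (div_le_div_of_nonneg_left hr.le (by positivity)
            (pow_le_pow_right₀ one_le_two (by omega))))
        rwa [show 2 * (r / 2 ^ (j + 1)) = r / 2 ^ j by rw [pow_succ]; field_simp] at this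
    _ ≤ ENNReal.ofReal (doublingConst n p) *
        ∑ j ∈ Finset.range (4 + N), truncDensity n p m (r / 2 ^ j) x := by
        rw [← Finset.mul_sum]
        gcongr
        intro j hj
        have := Finset.mem_range.1 (Finset.mem_filter.1 hj).1
        exact Finset.mem_range.2 (by omega)
    _ ≤ _ := by
        gcongr
        rw [Finset.sum_range_add]
        have h1 : ∑ j ∈ Finset.range 4, truncDensity n p m (r / 2 ^ j) x ≤ 8 := by
          refine (Finset.sum_le_sum fun j _ => truncDensity_le_two _ _).trans_eq ?_
          norm_num
        have h2 : ∑ j ∈ Finset.range N, truncDensity n p m (r / 2 ^ (4 + j)) x ≤ 1 := by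
          simp only [add_comm 4]
          exact hxD
        exact (add_le_add h1 h2).trans_eq (by norm_num)

lemma setLIntegral_pair_le (hp₁ : 1 < p) (hp₂ : p < n) (m : Measure (Euc n)) [IsFiniteMeasure m]
    {r : ℝ} (hr : 0 < r) {D : Set (Euc n)} (hD : MeasurableSet D) (j k : ℕ) :
    ∫⁻ x in D, ENNReal.ofReal (r / 2 ^ (j + 2))⁻¹ * truncDensity n p m (r / 2 ^ (j + 2)) x *
      (2 ^ ((k : ℝ) / 2) * (ENNReal.ofReal (r / 2 ^ (j + k + 2))⁻¹ *
        truncDensity n p m (r / 2 ^ (j + k + 2)) x) ^ (p - 1)) ≤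
    ENNReal.ofReal (doublingConst n p) * volume (ball (0 : Euc n) 1) *
      ((2 : ℝ≥0∞) ^ (-(1 / 2) : ℝ)) ^ k *
      ∫⁻ y, (thickening (r / 2 ^ (j + 2)) D).indicator
        (truncDensity n p m (r / 2 ^ (j + 1))) y ∂m := by
  set s := r / 2 ^ (j + 2) with hs
  set t := r / 2 ^ (j + k + 2) with ht
  have hs0 : 0 < s := by positivity
  have ht0 : 0 < t := by positivity
  have hts : t ≤ s := div_le_div_of_nonneg_left hr.le (by positivity)
    (pow_le_pow_right₀ one_le_two (by omega))
  have hts' : t = s * (2 ^ k)⁻¹ := by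
    rw [hs, ht, show j + k + 2 = j + 2 + k by ring, pow_add _ (j + 2)]; field_simp
  have h2s : r / 2 ^ (j + 1) = 2 * s := by rw [hs, pow_succ _ (j + 1)]; field_simp
  have hp0 : 0 < p - 1 := by linarith
  set F : Euc n → ℝ≥0∞ := fun y => ENNReal.ofReal (doublingConst n p) *
    (thickening s D).indicator (truncDensity n p m (r / 2 ^ (j + 1))) y with hF
  set c := ENNReal.ofReal s⁻¹ * 2 ^ ((k : ℝ) / 2) * ENNReal.ofReal (t ^ (1 - (n : ℝ))) with hc
  have hpt : ∀ x, ENNReal.ofReal s⁻¹ * truncDensity n p m s x *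
      (2 ^ ((k : ℝ) / 2) * (ENNReal.ofReal t⁻¹ * truncDensity n p m t x) ^ (p - 1)) ≤
      c * (truncDensity n p m s x * m (ball x t)) := by
    intro x
    have h1 : (ENNReal.ofReal t⁻¹ * truncDensity n p m t x) ^ (p - 1) ≤
        ENNReal.ofReal (t ^ (1 - (n : ℝ))) * m (ball x t) := by
      rw [ENNReal.mul_rpow_of_nonneg _ _ hp0.le, ENNReal.ofReal_rpow_of_pos (inv_pos.2 ht0)]
      refine (mul_le_mul_right (truncDensity_rpow_le hp₁ ht0 x) _).trans_eq ?_
      rw [← mul_assoc, ← ENNReal.ofReal_mul (by positivity), Real.inv_rpow ht0.le,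
        ← Real.rpow_neg ht0.le, ← Real.rpow_add ht0]
      congr 3; ring
    calc _ ≤ ENNReal.ofReal s⁻¹ * truncDensity n p m s x *
          (2 ^ ((k : ℝ) / 2) * (ENNReal.ofReal (t ^ (1 - (n : ℝ))) * m (ball x t))) := by gcongr
      _ = _ := by rw [hc]; ring
  have hmeas : Measurable fun x => truncDensity n p m s x * m (ball x t) :=
    (measurable_truncDensity hp₁ hs0).mul (lowerSemicontinuous_measure_ball m t).measurable
  have hFle : ∀ y, ∀ x ∈ D, dist x y < t → truncDensity n p m s x ≤ F y := by
    intro y x hx hxy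
    have hy : y ∈ thickening s D :=
      mem_thickening_iff.2 ⟨x, hx, by rw [dist_comm]; exact hxy.trans_le hts⟩
    simp only [hF, indicator_of_mem hy, h2s]
    exact truncDensity_le_of_dist_le hp₁ hp₂ hs0 (hxy.le.trans hts)
  have hvol : ∀ y : Euc n, volume (ball y t) =
      ENNReal.ofReal (t ^ (n : ℝ)) * volume (ball (0 : Euc n) 1) := by
    intro y
    rw [Measure.addHaar_ball_of_pos _ _ ht0, finrank_euclideanSpace_fin, Real.rpow_natCast]
  have hfac : c * ENNReal.ofReal (t ^ (n : ℝ)) = ((2 : ℝ≥0∞) ^ (-(1 / 2) : ℝ)) ^ k := by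
    have e2 : (2 : ℝ≥0∞) = ENNReal.ofReal 2 := by simp
    rw [hc, e2, ENNReal.ofReal_rpow_of_pos two_pos, ENNReal.ofReal_rpow_of_pos two_pos,
      ← ENNReal.ofReal_pow (by positivity), ← ENNReal.ofReal_mul (by positivity),
      ← ENNReal.ofReal_mul (by positivity), ← ENNReal.ofReal_mul (by positivity)]
    congr 1
    rw [mul_assoc, ← Real.rpow_add ht0, sub_add_cancel, Real.rpow_one, hts',
      ← Real.rpow_natCast (2 ^ (-(1 / 2) : ℝ)), ← Real.rpow_mul two_pos.le,
      ← Real.rpow_natCast 2 k, ← Real.rpow_neg two_pos.le]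
    have h3 : s⁻¹ * 2 ^ ((k : ℝ) / 2) * (s * 2 ^ (-(k : ℝ))) =
        2 ^ ((k : ℝ) / 2) * (2 : ℝ) ^ (-(k : ℝ)) := by field_simp
    rw [h3, ← Real.rpow_add two_pos]
    congr 1; ring
  calc _ ≤ ∫⁻ x in D, c * (truncDensity n p m s x * m (ball x t)) := lintegral_mono fun x => hpt x
    _ = c * ∫⁻ x in D, truncDensity n p m s x * m (ball x t) := lintegral_const_mul _ hmeas
    _ ≤ c * ∫⁻ y, F y * volume (ball y t) ∂m := by
        exact mul_le_mul_right
          (setLIntegral_mul_measure_ball_le m hD (measurable_truncDensity hp₁ hs0) hFle) c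
    _ = c * ((∫⁻ y, (thickening s D).indicator (truncDensity n p m (r / 2 ^ (j + 1))) y ∂m) *
        (ENNReal.ofReal (doublingConst n p) *
          (ENNReal.ofReal (t ^ (n : ℝ)) * volume (ball (0 : Euc n) 1)))) := by
        congr 1
        simp_rw [hF, hvol]
        rw [← lintegral_mul_const]
        · refine lintegral_congr fun y => ?_
          ring
        · exact (measurable_truncDensity hp₁ (by positivity)).indicator
            isOpen_thickening.measurableSet
    _ = _ := by rw [← hfac]; ring

lemma exists_energy_bound (hp₁ : 1 < p) (hp₂ : p < n) : ∃ C : ℝ≥0∞, C ≠ ⊤ ∧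
    ∀ (m : Measure (Euc n)) [IsFiniteMeasure m] (r : ℝ), 0 < r → ∀ N : ℕ,
      ∫⁻ x in sublevelSet n p m r N, (∑ j ∈ Finset.range N, ENNReal.ofReal (r / 2 ^ (j + 2))⁻¹ *
        truncDensity n p m (r / 2 ^ (j + 2)) x) ^ p ≤ C * m univ := by
  have hq : 0 < p - 1 := by linarith
  obtain ⟨A, hA, hAsum⟩ := ENNReal.exists_sum_rpow_le_weighted hq
  set θ : ℝ≥0∞ := (2 : ℝ≥0∞) ^ (-(1 / 2) : ℝ) with hθ
  have hθ1 : θ < 1 := ENNReal.rpow_lt_one_of_one_lt_of_neg (by norm_num) (by norm_num)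
  set K := ENNReal.ofReal (doublingConst n p) with hK
  set V := volume (ball (0 : Euc n) 1) with hV
  refine ⟨ENNReal.ofReal p * A * (K * V * (1 - θ)⁻¹ * (K * 9)), ?_, ?_⟩
  · have h1 : V ≠ ⊤ := measure_ball_lt_top.ne
    have h2 : (1 - θ)⁻¹ ≠ ⊤ := by
      rw [ENNReal.inv_ne_top]
      exact (tsub_pos_of_lt hθ1).ne'
    have h3 : K ≠ ⊤ := ENNReal.ofReal_ne_top
    finiteness
  intro m _ r hr N
  set D := sublevelSet n p m r N with hD
  have hDm : MeasurableSet D := measurableSet_sublevelSet hp₁ hr N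
  set g : ℕ → Euc n → ℝ≥0∞ := fun j x => ENNReal.ofReal (r / 2 ^ (j + 2))⁻¹ *
    truncDensity n p m (r / 2 ^ (j + 2)) x with hg
  have hgm : ∀ j, Measurable (g j) := fun j =>
    (measurable_truncDensity hp₁ (by positivity)).const_mul _
  set I : ℕ → Euc n → ℝ≥0∞ := fun j => (thickening (r / 2 ^ (j + 2)) D).indicator
        (truncDensity n p m (r / 2 ^ (j + 1))) with hI
  have hIm : ∀ j, Measurable (I j) := fun j =>
    (measurable_truncDensity hp₁ (by positivity)).indicator isOpen_thickening.measurableSet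
  have hmeas : ∀ j k : ℕ, Measurable fun x =>
      g j x * ((2 : ℝ≥0∞) ^ ((k : ℝ) / 2) * g (j + k) x ^ (p - 1)) := fun j k =>
    (hgm j).mul (((hgm (j + k)).pow_const _).const_mul _)
  have hpt : ∀ x, (∑ j ∈ Finset.range N, g j x) ^ p ≤ ENNReal.ofReal p * A *
      ∑ j ∈ Finset.range N, ∑ k ∈ Finset.range (N - j),
        g j x * ((2 : ℝ≥0∞) ^ ((k : ℝ) / 2) * g (j + k) x ^ (p - 1)) := by
    intro x
    refine (ENNReal.sum_rpow_le_sum_mul_tail hp₁ N fun j => g j x).trans ?_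
    rw [mul_assoc, Finset.mul_sum _ _ A]
    refine mul_le_mul_right (Finset.sum_le_sum fun j _ => ?_) _
    rw [← Finset.mul_sum, mul_left_comm]
    exact mul_le_mul_right (hAsum _ fun k => g (j + k) x) _
  calc ∫⁻ x in D, (∑ j ∈ Finset.range N, g j x) ^ p
      ≤ ∫⁻ x in D, ENNReal.ofReal p * A * ∑ j ∈ Finset.range N, ∑ k ∈ Finset.range (N - j),
        g j x * ((2 : ℝ≥0∞) ^ ((k : ℝ) / 2) * g (j + k) x ^ (p - 1)) :=
        lintegral_mono fun x => hpt x
    _ = ENNReal.ofReal p * A * ∑ j ∈ Finset.range N, ∑ k ∈ Finset.range (N - j),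
        ∫⁻ x in D, g j x * ((2 : ℝ≥0∞) ^ ((k : ℝ) / 2) * g (j + k) x ^ (p - 1)) := by
        rw [lintegral_const_mul _ (Finset.measurable_sum _ fun j _ =>
          Finset.measurable_sum _ fun k _ => hmeas j k),
          lintegral_finsetSum _ fun j _ => Finset.measurable_sum _ fun k _ => hmeas j k]
        congr 1
        refine Finset.sum_congr rfl fun j _ => ?_
        rw [lintegral_finsetSum _ fun k _ => hmeas j k]
    _ ≤ ENNReal.ofReal p * A * ∑ j ∈ Finset.range N, ∑ k ∈ Finset.range (N - j),
        K * V * θ ^ k * ∫⁻ y, I j y ∂m := by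
        gcongr with j _ k _
        exact setLIntegral_pair_le hp₁ hp₂ m hr hDm j k
    _ ≤ ENNReal.ofReal p * A * ∑ j ∈ Finset.range N,
        K * V * (1 - θ)⁻¹ * ∫⁻ y, I j y ∂m := by
        gcongr with j _
        rw [← Finset.sum_mul, ← Finset.mul_sum, ← ENNReal.tsum_geometric]
        gcongr
        exact ENNReal.sum_le_tsum _
    _ = ENNReal.ofReal p * A * (K * V * (1 - θ)⁻¹ * ∫⁻ y, ∑ j ∈ Finset.range N, I j y ∂m) := by
        rw [← Finset.mul_sum, lintegral_finsetSum _ fun j _ => hIm j]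
    _ ≤ ENNReal.ofReal p * A * (K * V * (1 - θ)⁻¹ * ∫⁻ _, K * 9 ∂m) := by
        gcongr with y
        exact sum_indicator_thickening_le hp₁ hp₂ hr N y
    _ = _ := by rw [lintegral_const]; ring

end Energy

/-! ### Smooth test functions for the superlevel sets of the Wolff sum -/

section TestFunction

variable {n : ℕ} {p : ℝ}

lemma deriv_smoothTransition_of_one_lt {s : ℝ} (hs : 1 < s) :
    deriv Real.smoothTransition s = 0 := by
  have : Real.smoothTransition =ᶠ[𝓝 s] fun _ => 1 := by
    filter_upwards [lt_mem_nhds hs] with t ht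
    exact Real.smoothTransition.one_of_one_le ht.le
  rw [this.deriv_eq, deriv_const]

lemma exists_abs_deriv_smoothTransition_le :
    ∃ L : ℝ, 0 ≤ L ∧ ∀ s, |deriv Real.smoothTransition s| ≤ L := by
  have hc : Continuous (deriv Real.smoothTransition) :=
    (Real.smoothTransition.contDiff (n := 1)).continuous_deriv (by simp)
  obtain ⟨L, hL⟩ := isCompact_Icc.exists_bound_of_continuousOn (s := Icc (0 : ℝ) 1) hc.continuousOn
  have hL0 : 0 ≤ L := (norm_nonneg _).trans (hL 0 (by simp))
  refine ⟨L, hL0, fun s => ?_⟩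
  rcases lt_or_ge s 0 with h | h
  · have : Real.smoothTransition =ᶠ[𝓝 s] fun _ => 0 := by
      filter_upwards [gt_mem_nhds h] with t ht
      exact Real.smoothTransition.zero_of_nonpos ht.le
    rw [this.deriv_eq, deriv_const]; simpa using hL0
  rcases lt_or_ge 1 s with h' | h'
  · rw [deriv_smoothTransition_of_one_lt h']; simpa using hL0
  · exact hL s ⟨h, h'⟩

lemma exists_smooth_wolff_sum (hp₁ : 1 < p) (hp₂ : p < n) : ∃ M : ℝ, 0 ≤ M ∧
    ∀ (m : Measure (Euc n)) (r : ℝ), 0 < r → ∀ j : ℕ,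
      ∃ h : Euc n → ℝ, ContDiff ℝ (⊤ : ℕ∞) h ∧
        (∀ x, (truncDensity n p m (r / 2 ^ (j + 4)) x).toReal ≤ h x) ∧
        (∀ x, h x ≠ 0 → ∃ y, dist x y < r / 8 ∧ m (ball y (r / 8)) ≠ 0) ∧
        ∀ x, ‖fderiv ℝ h x‖ ≤
          M * ((r / 2 ^ (j + 2))⁻¹ * (truncDensity n p m (r / 2 ^ (j + 2)) x).toReal) := by
  obtain ⟨C, hC, hmol⟩ := exists_mollification n
  set K := doublingConst n p with hK
  have hK0 : 0 < K := doublingConst_pos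
  refine ⟨K * (C * K * 4), by positivity, fun m r hr j => ?_⟩
  obtain ⟨h, hs, hlow, hup, hgrad⟩ := hmol (r / 2 ^ (j + 4)) (by positivity)
    (fun x => (truncDensity n p m (r / 2 ^ (j + 3)) x).toReal)
    (measurable_truncDensity hp₁ (by positivity)).ennreal_toReal (fun _ => ENNReal.toReal_nonneg)
    ⟨2, fun x => ENNReal.toReal_le_of_le_ofReal (by norm_num)
      (by simpa using truncDensity_le_two _ _)⟩
  have hdouble : ∀ (i : ℕ) (x y : Euc n), dist y x ≤ r / 2 ^ (i + 1) →
      (truncDensity n p m (r / 2 ^ (i + 1)) y).toReal ≤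
        K * (truncDensity n p m (r / 2 ^ i) x).toReal := by
    intro i x y hxy
    have := truncDensity_le_of_dist_le (m := m) hp₁ hp₂ (by positivity) hxy
    rw [show 2 * (r / 2 ^ (i + 1)) = r / 2 ^ i by rw [pow_succ]; field_simp] at this
    have h2 := ENNReal.toReal_mono
      (ENNReal.mul_ne_top ENNReal.ofReal_ne_top (truncDensity_ne_top _ _)) this
    rwa [ENNReal.toReal_mul, ENNReal.toReal_ofReal doublingConst_pos.le] at h2
  have hscale : r / 2 ^ (j + 4) ≤ r / 2 ^ (j + 3) :=
    div_le_div_of_nonneg_left hr.le (by positivity) (pow_le_pow_right₀ one_le_two (by omega))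
  have hscale0 : r / 2 ^ (j + 3) ≤ r / 8 :=
    div_le_div_of_nonneg_left hr.le (by positivity) (by
      calc (8 : ℝ) = 2 ^ 3 := by norm_num
        _ ≤ 2 ^ (j + 3) := pow_le_pow_right₀ one_le_two (by omega))
  have h_nonneg : ∀ x, 0 ≤ h x := fun x => hlow x 0 fun _ _ => ENNReal.toReal_nonneg
  refine ⟨fun x => K * h x, contDiff_const.mul hs, fun x => ?_, fun x hx => ?_, fun x => ?_⟩
  · rw [← inv_mul_le_iff₀ hK0]
    refine hlow x _ fun y hy => ?_
    rw [inv_mul_le_iff₀ hK0]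
    exact hdouble (j + 3) y x (by rw [dist_comm]; exact (mem_ball.1 hy).le)
  · by_contra! hcon
    apply hx
    rw [mul_eq_zero]
    right
    refine le_antisymm (hup x 0 fun y hy => ?_) (h_nonneg x)
    have hy' : dist x y < r / 8 := by
      rw [dist_comm]; exact (mem_ball.1 hy).trans_le (hscale.trans hscale0)
    have h0 : truncDensity n p m (r / 2 ^ (j + 3)) y = 0 := by
      by_contra hne
      exact measure_ball_ne_zero_of_truncDensity_ne_zero hp₁ hne
        (measure_mono_null (ball_subset_ball hscale0) (hcon y hy'))
    simp [h0]
  · rw [fderiv_const_mul (hs.differentiable (by simp) x), norm_smul, Real.norm_of_nonneg hK0.le,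
      mul_assoc K]
    refine mul_le_mul_of_nonneg_left ((hgrad x
      (K * (truncDensity n p m (r / 2 ^ (j + 2)) x).toReal) fun y hy => ?_).trans_eq ?_) hK0.le
    · exact hdouble (j + 2) x y ((mem_ball.1 hy).le.trans hscale)
    · rw [pow_add _ j 4, pow_add _ j 2]; field_simp; norm_num; ring

lemma exists_test_function (hp₁ : 1 < p) (hp₂ : p < n) : ∃ C : ℝ≥0∞, C ≠ ⊤ ∧
    ∀ (m : Measure (Euc n)) [IsFiniteMeasure m] (r : ℝ), 0 < r → ∀ (N : ℕ) (A : Set (Euc n)),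
      m Aᶜ = 0 → ∃ u : Euc n → ℝ, ContDiff ℝ (⊤ : ℕ∞) u ∧
        (∀ x ∉ sublevelSet n p m r N, 1 ≤ u x) ∧
        (∀ x, u x ≠ 0 → ∃ z ∈ A, dist x z < r / 4) ∧
        ∫⁻ x, ENNReal.ofReal (‖fderiv ℝ u x‖ ^ p) ≤ C * m univ := by
  obtain ⟨M, hM, hsum⟩ := exists_smooth_wolff_sum hp₁ hp₂
  obtain ⟨L, hL, hderiv⟩ := exists_abs_deriv_smoothTransition_le
  obtain ⟨C, hC, hen⟩ := exists_energy_bound hp₁ hp₂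
  have hp0 : 0 < p := by linarith
  refine ⟨ENNReal.ofReal (L * M) ^ p * C,
    ENNReal.mul_ne_top (ENNReal.rpow_ne_top_of_nonneg hp0.le ENNReal.ofReal_ne_top) hC, ?_⟩
  intro m _ r hr N A hA
  choose h hs hlow hsupp hgrad using hsum m r hr
  set w : Euc n → ℝ := fun x => ∑ j ∈ Finset.range N, h j x with hw
  have hws : ContDiff ℝ (⊤ : ℕ∞) w := ContDiff.sum fun j _ => hs j
  have hwd : ∀ x, DifferentiableAt ℝ w x := fun x => hws.differentiable (by simp) x
  have hout : ∀ x ∉ sublevelSet n p m r N, 1 < w x := by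
    intro x hx
    simp only [sublevelSet, mem_ofPred_eq, not_le] at hx
    have h1 : 1 < (∑ j ∈ Finset.range N, truncDensity n p m (r / 2 ^ (j + 4)) x).toReal := by
      rw [← ENNReal.toReal_one]
      exact (ENNReal.toReal_lt_toReal (by simp)
        (ENNReal.sum_ne_top.2 fun _ _ => truncDensity_ne_top _ _)).2 hx
    rw [ENNReal.toReal_sum fun _ _ => truncDensity_ne_top _ _] at h1
    exact h1.trans_le (Finset.sum_le_sum fun j _ => hlow j x)
  set u : Euc n → ℝ := fun x => Real.smoothTransition (w x) with hu
  refine ⟨u, Real.smoothTransition.contDiff.comp hws, fun x hx => ?_, fun x hx => ?_, ?_⟩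
  · exact (Real.smoothTransition.one_of_one_le (hout x hx).le).ge
  · have h1 : ∃ j ∈ Finset.range N, h j x ≠ 0 := by
      apply Finset.exists_ne_zero_of_sum_ne_zero
      intro h0
      exact hx (Real.smoothTransition.zero_of_nonpos (le_of_eq h0))
    obtain ⟨j, -, hj⟩ := h1
    obtain ⟨y, hxy, hy⟩ := hsupp j x hj
    obtain ⟨z, hz, hzA⟩ : ∃ z ∈ ball y (r / 8), z ∈ A := by
      by_contra! hcon
      exact hy (measure_mono_null (fun z hz => hcon z hz) hA)
    refine ⟨z, hzA, (dist_triangle x y z).trans_lt ?_⟩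
    rw [mem_ball, dist_comm] at hz
    linarith
  · have hfd : ∀ x, fderiv ℝ u x = deriv Real.smoothTransition (w x) • fderiv ℝ w x := by
      intro x
      have h1 : HasDerivAt Real.smoothTransition (deriv Real.smoothTransition (w x)) (w x) :=
        ((Real.smoothTransition.contDiff (n := 1)).differentiable (by simp) _).hasDerivAt
      exact (h1.comp_hasFDerivAt x (hwd x).hasFDerivAt).fderiv
    set g : Euc n → ℝ≥0∞ := fun x => ∑ j ∈ Finset.range N, ENNReal.ofReal (r / 2 ^ (j + 2))⁻¹ *
        truncDensity n p m (r / 2 ^ (j + 2)) x with hg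
    have hbound : ∀ x, ENNReal.ofReal (‖fderiv ℝ u x‖ ^ p) ≤
        (sublevelSet n p m r N).indicator (fun x => ENNReal.ofReal (L * M) ^ p * g x ^ p) x := by
      intro x
      by_cases hx : x ∈ sublevelSet n p m r N
      · rw [indicator_of_mem hx, ← ENNReal.mul_rpow_of_nonneg _ _ hp0.le,
          ← ENNReal.ofReal_rpow_of_nonneg (norm_nonneg _) hp0.le]
        refine ENNReal.rpow_le_rpow ?_ hp0.le
        have h1 : ‖fderiv ℝ w x‖ ≤ M * ∑ j ∈ Finset.range N, ((r / 2 ^ (j + 2))⁻¹ *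
            (truncDensity n p m (r / 2 ^ (j + 2)) x).toReal) := by
          have h2 : fderiv ℝ w x = ∑ j ∈ Finset.range N, fderiv ℝ (h j) x :=
            fderiv_fun_sum fun j _ => (hs j).differentiable (by simp) x
          rw [h2, Finset.mul_sum]
          exact norm_sum_le_of_le _ fun j _ => hgrad j x
        have h3 : ‖fderiv ℝ u x‖ ≤ L * M * ∑ j ∈ Finset.range N, ((r / 2 ^ (j + 2))⁻¹ *
            (truncDensity n p m (r / 2 ^ (j + 2)) x).toReal) := by
          rw [hfd, norm_smul, mul_assoc]
          exact mul_le_mul (hderiv _) h1 (norm_nonneg _) hL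
        refine (ENNReal.ofReal_le_ofReal h3).trans_eq ?_
        rw [ENNReal.ofReal_mul (by positivity), hg, ENNReal.ofReal_sum_of_nonneg fun _ _ => by
          positivity]
        congr 1
        refine Finset.sum_congr rfl fun j _ => ?_
        rw [ENNReal.ofReal_mul (by positivity), ENNReal.ofReal_toReal (truncDensity_ne_top _ _)]
      · rw [indicator_of_notMem hx, hfd, deriv_smoothTransition_of_one_lt (hout x hx)]
        simp [hp0.ne']
    have hgm : Measurable g := Finset.measurable_sum _ fun j _ =>
      (measurable_truncDensity hp₁ (by positivity)).const_mul _
    calc ∫⁻ x, ENNReal.ofReal (‖fderiv ℝ u x‖ ^ p)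
        ≤ ∫⁻ x, (sublevelSet n p m r N).indicator
          (fun x => ENNReal.ofReal (L * M) ^ p * g x ^ p) x := lintegral_mono hbound
      _ = ENNReal.ofReal (L * M) ^ p * ∫⁻ x in sublevelSet n p m r N, g x ^ p := by
        rw [lintegral_indicator (measurableSet_sublevelSet hp₁ hr N),
          lintegral_const_mul _ (hgm.pow_const p)]
      _ ≤ ENNReal.ofReal (L * M) ^ p * (C * m univ) := by
        gcongr
        exact hen m r hr N
      _ = _ := by rw [mul_assoc]

end TestFunction

/-! ### Capacity of the superlevel sets of the Wolff sum -/

section Capacity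

variable {n : ℕ} {p : ℝ}

/-- The set where the sum of the truncated densities over all dyadic scales exceeds one. -/
def superlevelSet (n : ℕ) (p : ℝ) (m : Measure (Euc n)) (r : ℝ) : Set (Euc n) :=
  ⋃ N, (sublevelSet n p m r N)ᶜ

lemma isOpen_compl_sublevelSet (hp₁ : 1 < p) {m : Measure (Euc n)} {r : ℝ} (hr : 0 < r)
    (N : ℕ) : IsOpen (sublevelSet n p m r N)ᶜ := by
  have h : LowerSemicontinuous fun x =>
      ∑ j ∈ Finset.range N, truncDensity n p m (r / 2 ^ (j + 4)) x :=
    lowerSemicontinuous_sum fun j _ => lowerSemicontinuous_truncDensity hp₁ (by positivity)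
  have := h.isOpen_preimage 1
  convert this using 1
  ext x
  simp [sublevelSet]

lemma antitone_sublevelSet (m : Measure (Euc n)) (r : ℝ) : Antitone (sublevelSet n p m r) := by
  intro N N' h x hx
  simp only [sublevelSet, mem_ofPred_eq] at hx ⊢
  exact (Finset.sum_le_sum_of_subset (Finset.range_mono h)).trans hx

lemma mem_wAnn_iff {i : ℕ} {x x₀ : Euc n} : x ∈ wAnn n i x₀ ↔
    (2 : ℝ) ^ (-(i : ℤ)) ≤ ‖x - x₀‖ ∧ ‖x - x₀‖ ≤ 2 * (2 : ℝ) ^ (-(i : ℤ)) := by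
  rw [← zpow_one_add₀ two_ne_zero, add_comm (1 : ℤ)]
  rfl

lemma mem_wAnnO_iff {i : ℕ} {x x₀ : Euc n} : x ∈ wAnnO n i x₀ ↔
    (2 : ℝ) ^ (-(i : ℤ)) / 2 ≤ ‖x - x₀‖ ∧ ‖x - x₀‖ ≤ 4 * (2 : ℝ) ^ (-(i : ℤ)) := by
  have h1 : (2 : ℝ) ^ (-(i : ℤ)) / 2 = 2 ^ (-(i : ℤ) - 1) := by
    rw [zpow_sub₀ two_ne_zero, zpow_one]
  have h2 : 4 * (2 : ℝ) ^ (-(i : ℤ)) = 2 ^ (-(i : ℤ) + 2) := by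
    rw [zpow_add₀ two_ne_zero, mul_comm]; norm_num
  rw [h1, h2]
  rfl

lemma exists_varCap_superlevelSet_le (hp₁ : 1 < p) (hp₂ : p < n) : ∃ C : ℝ≥0∞, C ≠ ⊤ ∧
    ∀ (m : Measure (Euc n)) [IsFiniteMeasure m] (x₀ : Euc n) (i : ℕ) (R : ℝ),
      R = (2 : ℝ) ^ (-(i : ℤ)) →
      m {y | 3 / 4 * R < ‖y - x₀‖ ∧ ‖y - x₀‖ < 3 * R}ᶜ = 0 →
      ∀ F : Set (Euc n), F ⊆ superlevelSet n p m (R / 2) →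
      varCap n p (F ∩ wAnn n i x₀) (wAnnO n i x₀) ≤ C * m univ := by
  obtain ⟨C, hC, htest⟩ := exists_test_function hp₁ hp₂
  refine ⟨C, hC, fun m _ x₀ i R hR hm F hF => ?_⟩
  have hR0 : 0 < R := by rw [hR]; positivity
  set G : Set (Euc n) := superlevelSet n p m (R / 2) ∩
    {x | R / 2 < ‖x - x₀‖ ∧ ‖x - x₀‖ < 4 * R} with hG
  have hGo : IsOpen G :=
    (isOpen_iUnion fun N => isOpen_compl_sublevelSet hp₁ (half_pos hR0) N).inter
      (isOpen_Ioo.preimage (f := fun x => ‖x - x₀‖) (by fun_prop))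
  have hFG : F ∩ wAnn n i x₀ ⊆ G := by
    rintro x ⟨hx, hx'⟩
    rw [mem_wAnn_iff, ← hR] at hx'
    exact ⟨hF hx, by linarith, by linarith⟩
  have hGΩ : G ⊆ wAnnO n i x₀ := by
    rintro x ⟨-, hx⟩
    rw [mem_wAnnO_iff, ← hR]
    exact ⟨hx.1.le, hx.2.le⟩
  refine (iInf₂_le G ⟨hGo, hFG, hGΩ⟩).trans (iSup₂_le ?_)
  rintro K ⟨hK, hKG⟩
  obtain ⟨N, hN⟩ := hK.elim_directed_cover (fun N => (sublevelSet n p m (R / 2) N)ᶜ)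
    (fun N => isOpen_compl_sublevelSet hp₁ (half_pos hR0) N) (fun x hx => (hKG hx).1)
    (Monotone.directed_le fun a b hab => compl_subset_compl.2 (antitone_sublevelSet _ _ hab))
  obtain ⟨u, hus, hu1, husupp, hue⟩ := htest m (R / 2) (half_pos hR0) N _ hm
  have hts : tsupport u ⊆ {x | 5 / 8 * R ≤ ‖x - x₀‖ ∧ ‖x - x₀‖ ≤ 25 / 8 * R} := by
    refine closure_minimal ?_ (isClosed_Icc.preimage (f := fun x => ‖x - x₀‖) (by fun_prop))
    intro x hx
    obtain ⟨z, hz, hxz⟩ := husupp x hx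
    rw [dist_eq_norm] at hxz
    have h1 : ‖z - x₀‖ ≤ ‖x - z‖ + ‖x - x₀‖ := by
      rw [norm_sub_rev x z]
      simpa using norm_add_le (z - x) (x - x₀)
    have h2 : ‖x - x₀‖ ≤ ‖x - z‖ + ‖z - x₀‖ := by
      simpa using norm_add_le (x - z) (z - x₀)
    obtain ⟨hz1, hz2⟩ := hz
    exact ⟨by linarith, by linarith⟩
  have hle : varCapCompact n p K (wAnnO n i x₀) ≤
      ∫⁻ x in wAnnO n i x₀, ENNReal.ofReal (‖fderiv ℝ u x‖ ^ p) := by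
    refine sInf_le ?_
    rw [mem_ofPred_eq]
    refine ⟨u, hus, ?_, ?_, fun x hx => hu1 x ?_, rfl⟩
    · refine (isCompact_closedBall x₀ (25 / 8 * R)).of_isClosed_subset (isClosed_tsupport u) ?_
      intro x hx
      rw [mem_closedBall, dist_eq_norm]
      exact (hts hx).2
    · intro x hx
      obtain ⟨h1, h2⟩ := hts hx
      rw [mem_wAnnO_iff, ← hR]
      exact ⟨by linarith, by linarith⟩
    · exact hN hx
  exact hle.trans ((setLIntegral_le_lintegral _ _).trans hue)

end Capacity

/-! ### Capacity of spheres -/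

section Sphere

variable {n : ℕ} {p : ℝ}

lemma le_add_rpow_of_pos (hp₁ : 1 < p) {h e : ℝ} (hh : 0 ≤ h) (he : 0 < e) :
    h ≤ e + e ^ (1 - p) * h ^ p := by
  rcases le_or_gt h e with hle | hlt
  · have : 0 ≤ e ^ (1 - p) * h ^ p := by positivity
    linarith
  · have h0 : 0 < h := he.trans hlt
    have h1 : e ^ (1 - p) * h ^ p = h * (h / e) ^ (p - 1) := by
      rw [Real.div_rpow hh he.le, Real.rpow_sub he, Real.rpow_sub_one h0.ne',
        Real.rpow_sub_one he.ne', Real.rpow_one]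
      field_simp
    have h2 : 1 ≤ (h / e) ^ (p - 1) :=
      Real.one_le_rpow ((one_le_div he).2 hlt.le) (by linarith)
    rw [h1]
    nlinarith

lemma one_le_lintegral_ray (hp₁ : 1 < p) {u : Euc n → ℝ} (hu : ContDiff ℝ (⊤ : ℕ∞) u)
    {x₀ w : Euc n} {R : ℝ} (hR : 0 < R) (hsphere : ∀ x ∈ sphere x₀ R, 1 ≤ u x)
    (hsupp : ∀ x ∉ ball x₀ (2 * R), u x = 0) (hw₁ : R ≤ ‖w‖) (hw₂ : ‖w‖ ≤ 2 * R) :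
    1 ≤ ENNReal.ofReal (2 * 3 ^ (p - 1) * (2 * R) ^ p) *
      ∫⁻ s in Ioc (1 / 2 : ℝ) 2, ENNReal.ofReal (‖fderiv ℝ u (x₀ + s • w)‖ ^ p) := by
  have hw0 : 0 < ‖w‖ := hR.trans_le hw₁
  have hcf : Continuous fun s : ℝ => ‖fderiv ℝ u (x₀ + s • w)‖ :=
    ((hu.continuous_fderiv (by simp)).comp (by fun_prop)).norm
  have hcp : Continuous fun s : ℝ => ‖fderiv ℝ u (x₀ + s • w)‖ ^ p :=
    hcf.rpow_const fun _ => Or.inr (by linarith)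
  have hcd : Continuous fun s : ℝ => fderiv ℝ u (x₀ + s • w) w :=
    ((hu.continuous_fderiv (by simp)).comp (by fun_prop)).clm_apply continuous_const
  have hderiv : ∀ s : ℝ, HasDerivAt (fun s : ℝ => u (x₀ + s • w)) (fderiv ℝ u (x₀ + s • w) w) s := by
    intro s
    have h1 : HasFDerivAt u (fderiv ℝ u (x₀ + s • w)) (x₀ + s • w) :=
      (hu.differentiable (by simp)).differentiableAt.hasFDerivAt
    have h2 : HasDerivAt (fun s : ℝ => x₀ + s • w) w s := by
      simpa using ((hasDerivAt_id s).smul_const w).const_add x₀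
    exact h1.comp_hasDerivAt s h2
  set a : ℝ := R / ‖w‖ with ha
  have ha₁ : 1 / 2 ≤ a := by rw [ha, div_le_div_iff₀ two_pos hw0]; linarith
  have ha₂ : a ≤ 1 := (div_le_one hw0).2 hw₁
  have hφa : 1 ≤ u (x₀ + a • w) := by
    apply hsphere
    rw [mem_sphere, dist_eq_norm, add_sub_cancel_left, norm_smul, Real.norm_of_nonneg (by linarith),
      ha, div_mul_cancel₀ _ hw0.ne']
  have hφ2 : u (x₀ + (2 : ℝ) • w) = 0 := by
    apply hsupp
    rw [mem_ball, dist_eq_norm, add_sub_cancel_left, norm_smul, Real.norm_of_nonneg two_pos.le]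
    linarith
  have hftc : ∫ s in a..2, fderiv ℝ u (x₀ + s • w) w = u (x₀ + (2 : ℝ) • w) - u (x₀ + a • w) :=
    intervalIntegral.integral_eq_sub_of_hasDerivAt (fun s _ => hderiv s) (hcd.intervalIntegrable _ _)
  have hpt : ∀ s : ℝ, -(fderiv ℝ u (x₀ + s • w) w) ≤
      1 / 3 + 3 ^ (p - 1) * (2 * R) ^ p * ‖fderiv ℝ u (x₀ + s • w)‖ ^ p := by
    intro s
    have h1 : -(fderiv ℝ u (x₀ + s • w) w) ≤ 2 * R * ‖fderiv ℝ u (x₀ + s • w)‖ := by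
      have := (fderiv ℝ u (x₀ + s • w)).le_opNorm w
      have h3 := neg_le_abs (fderiv ℝ u (x₀ + s • w) w)
      rw [Real.norm_eq_abs] at this
      nlinarith [norm_nonneg (fderiv ℝ u (x₀ + s • w))]
    have h2 := le_add_rpow_of_pos hp₁ (h := 2 * R * ‖fderiv ℝ u (x₀ + s • w)‖) (by positivity)
      (show (0 : ℝ) < 1 / 3 by norm_num)
    have h3 : (1 / 3 : ℝ) ^ (1 - p) = 3 ^ (p - 1) := by
      rw [one_div, Real.inv_rpow (by norm_num), ← Real.rpow_neg (by norm_num), neg_sub]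
    rw [h3, Real.mul_rpow (by positivity) (norm_nonneg _), ← mul_assoc] at h2
    linarith
  set I : ℝ := ∫ s in (1 / 2 : ℝ)..2, ‖fderiv ℝ u (x₀ + s • w)‖ ^ p with hI
  have hle : 1 ≤ 2 * 3 ^ (p - 1) * (2 * R) ^ p * I := by
    have h1 : ∫ s in a..2, -(fderiv ℝ u (x₀ + s • w) w) ≤
        ∫ s in a..2, (1 / 3 + 3 ^ (p - 1) * (2 * R) ^ p * ‖fderiv ℝ u (x₀ + s • w)‖ ^ p) :=
      intervalIntegral.integral_mono_on (by linarith) (hcd.neg.intervalIntegrable _ _)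
        ((continuous_const.add (continuous_const.mul hcp)).intervalIntegrable _ _)
        fun s _ => hpt s
    have h2 : ∫ s in a..2, (1 / 3 + 3 ^ (p - 1) * (2 * R) ^ p * ‖fderiv ℝ u (x₀ + s • w)‖ ^ p) ≤
        ∫ s in (1 / 2 : ℝ)..2,
          (1 / 3 + 3 ^ (p - 1) * (2 * R) ^ p * ‖fderiv ℝ u (x₀ + s • w)‖ ^ p) := by
      refine intervalIntegral.integral_mono_interval ha₁ (by linarith) le_rfl ?_
        ((continuous_const.add (continuous_const.mul hcp)).intervalIntegrable _ _)
      exact Eventually.of_forall fun s => by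
        simp only [Pi.zero_apply]
        positivity
    rw [intervalIntegral.integral_neg, hftc, hφ2] at h1
    have h3 : ∫ s in (1 / 2 : ℝ)..2,
        (1 / 3 + 3 ^ (p - 1) * (2 * R) ^ p * ‖fderiv ℝ u (x₀ + s • w)‖ ^ p) =
        1 / 2 + 3 ^ (p - 1) * (2 * R) ^ p * I := by
      have hc : Continuous fun s : ℝ =>
          3 ^ (p - 1) * (2 * R) ^ p * ‖fderiv ℝ u (x₀ + s • w)‖ ^ p := continuous_const.mul hcp
      rw [intervalIntegral.integral_add (continuous_const.intervalIntegrable _ _)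
        (hc.intervalIntegrable _ _), intervalIntegral.integral_const,
        intervalIntegral.integral_const_mul, ← hI, smul_eq_mul]
      norm_num
    linarith
  have hI' : ENNReal.ofReal I =
      ∫⁻ s in Ioc (1 / 2 : ℝ) 2, ENNReal.ofReal (‖fderiv ℝ u (x₀ + s • w)‖ ^ p) := by
    rw [hI, intervalIntegral.integral_of_le (by norm_num)]
    exact ofReal_integral_eq_lintegral_ofReal
      ((hcp.intervalIntegrable (1 / 2) 2).1) (Eventually.of_forall fun s => by positivity)
  rw [← hI', ← ENNReal.ofReal_mul (by positivity)]
  exact ENNReal.one_le_ofReal.2 hle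

lemma lintegral_comp_add_smul (f : Euc n → ℝ≥0∞) (hf : Measurable f) (x₀ : Euc n) {s : ℝ}
    (hs : 1 / 2 < s) : ∫⁻ w, f (x₀ + s • w) ≤ 2 ^ n * ∫⁻ x, f x := by
  have hs0 : 0 < s := by linarith
  have h1 : ∫⁻ w, f (x₀ + s • w) = ∫⁻ x, f (x₀ + x) ∂(Measure.map (s • ·) volume) :=
    (lintegral_map (hf.comp (measurable_const_add x₀)) (measurable_const_smul s)).symm
  rw [h1, Measure.map_addHaar_smul volume hs0.ne', lintegral_smul_measure,
    lintegral_add_left_eq_self f x₀, smul_eq_mul]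
  gcongr
  rw [finrank_euclideanSpace_fin, abs_of_nonneg (by positivity), ← inv_pow,
    ENNReal.ofReal_pow (by positivity)]
  gcongr
  rw [← ENNReal.ofReal_ofNat]
  refine ENNReal.ofReal_le_ofReal ?_
  rw [inv_le_comm₀ hs0 (by norm_num)]
  norm_num
  linarith

lemma exists_le_varCapCompact_sphere (hp₁ : 1 < p) (hp₂ : p < n) : ∃ c : ℝ≥0∞, c ≠ 0 ∧
    ∀ (x₀ : Euc n) (R : ℝ), 0 < R →
      c * ENNReal.ofReal (R ^ ((n : ℝ) - p)) ≤
        varCapCompact n p (sphere x₀ R) (ball x₀ (2 * R)) := by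
  have hn : 0 < n := by
    have : (0 : ℝ) < n := by linarith
    exact_mod_cast this
  have : Nonempty (Fin n) := ⟨⟨0, hn⟩⟩
  set A : ℝ → Set (Euc n) := fun R => {w | ‖w‖ ∈ Icc R (2 * R)} with hA
  have hAm : ∀ R, MeasurableSet (A R) := fun R => measurableSet_Icc.preimage measurable_norm
  have hA1 : volume (A 1) ≠ 0 := by
    have ho : IsOpen {w : Euc n | ‖w‖ ∈ Ioo (1 : ℝ) 2} := isOpen_Ioo.preimage continuous_norm
    have hne : {w : Euc n | ‖w‖ ∈ Ioo (1 : ℝ) 2}.Nonempty := by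
      obtain ⟨w, hw⟩ := exists_norm_eq (Euc n) (show (0 : ℝ) ≤ 3 / 2 by norm_num)
      exact ⟨w, by rw [mem_ofPred_eq, hw]; norm_num⟩
    refine ((ho.measure_pos volume hne).trans_le (measure_mono ?_)).ne'
    intro w hw
    simp only [hA, mem_ofPred_eq, mul_one] at hw ⊢
    exact Ioo_subset_Icc_self hw
  set K : ℝ := 2 * 3 ^ (p - 1) * 2 ^ p with hK
  have hK0 : 0 < K := by positivity
  set K' : ℝ≥0∞ := ENNReal.ofReal K * (2 ^ n * ENNReal.ofReal (3 / 2)) with hK'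
  have hK'0 : K' ≠ 0 := by simp [hK', hK0]
  have hK't : K' ≠ ⊤ := by
    rw [hK']
    exact ENNReal.mul_ne_top ENNReal.ofReal_ne_top
      (ENNReal.mul_ne_top (by simp) ENNReal.ofReal_ne_top)
  refine ⟨volume (A 1) / K', by simp [ENNReal.div_eq_zero_iff, hA1, hK't], fun x₀ R hR => ?_⟩
  refine le_sInf ?_
  rintro c ⟨u, hu, -, hts, hu1, rfl⟩
  set f : Euc n → ℝ≥0∞ := fun x => ENNReal.ofReal (‖fderiv ℝ u x‖ ^ p) with hf
  have hfm : Measurable f :=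
    ENNReal.measurable_ofReal.comp
      ((hu.continuous_fderiv (by simp)).norm.measurable.pow_const p)
  have hJ : ∫⁻ x in ball x₀ (2 * R), f x = ∫⁻ x, f x := by
    refine setLIntegral_eq_of_support_subset ?_
    intro x hx
    refine hts (support_fderiv_subset ℝ ?_)
    rw [Function.mem_support] at hx ⊢
    intro h0
    apply hx
    simp only [hf, h0, norm_zero]
    rw [Real.zero_rpow (by linarith), ENNReal.ofReal_zero]
  change _ ≤ ∫⁻ x in ball x₀ (2 * R), f x
  rw [hJ]
  have hAR : ENNReal.ofReal (R ^ n) * volume (A 1) ≤ volume (A R) := by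
    have h1 := Measure.addHaar_smul (volume : Measure (Euc n)) R (A 1)
    rw [finrank_euclideanSpace_fin, abs_of_nonneg (by positivity)] at h1
    rw [← h1]
    refine measure_mono ?_
    rintro _ ⟨w, hw, rfl⟩
    simp only [hA, mem_ofPred_eq, mem_Icc] at hw ⊢
    rw [norm_smul, Real.norm_of_nonneg hR.le]
    constructor <;> nlinarith [hw.1, hw.2]
  have hmain : volume (A R) ≤ ENNReal.ofReal (K * R ^ p) *
      (2 ^ n * ENNReal.ofReal (3 / 2) * ∫⁻ x, f x) := by
    have hmeas : Measurable fun q : Euc n × ℝ => f (x₀ + q.2 • q.1) :=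
      hfm.comp (by fun_prop)
    calc volume (A R) = ∫⁻ w in A R, 1 := by simp
      _ ≤ ∫⁻ w in A R, ENNReal.ofReal (K * R ^ p) * ∫⁻ s in Ioc (1 / 2 : ℝ) 2, f (x₀ + s • w) := by
        refine setLIntegral_mono' (hAm R) fun w hw => ?_
        have := one_le_lintegral_ray hp₁ hu hR hu1
          (fun x hx => image_eq_zero_of_notMem_tsupport fun h => hx (hts h)) hw.1 hw.2
        rwa [Real.mul_rpow two_pos.le hR.le, ← mul_assoc] at this
      _ = ENNReal.ofReal (K * R ^ p) * ∫⁻ w in A R, ∫⁻ s in Ioc (1 / 2 : ℝ) 2, f (x₀ + s • w) :=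
        lintegral_const_mul' _ _ ENNReal.ofReal_ne_top
      _ ≤ _ := by
        gcongr
        rw [lintegral_lintegral_swap hmeas.aemeasurable]
        calc ∫⁻ s in Ioc (1 / 2 : ℝ) 2, ∫⁻ w in A R, f (x₀ + s • w)
            ≤ ∫⁻ s in Ioc (1 / 2 : ℝ) 2, 2 ^ n * ∫⁻ x, f x := by
              refine setLIntegral_mono' measurableSet_Ioc fun s hs => ?_
              exact (setLIntegral_le_lintegral _ _).trans
                (lintegral_comp_add_smul f hfm x₀ hs.1)
          _ = 2 ^ n * ENNReal.ofReal (3 / 2) * ∫⁻ x, f x := by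
              rw [setLIntegral_const, Real.volume_Ioc]
              norm_num
              ring
  have hRp : ENNReal.ofReal (R ^ p) ≠ 0 := by simp; positivity
  have hRn : ENNReal.ofReal (R ^ n) =
      ENNReal.ofReal (R ^ p) * ENNReal.ofReal (R ^ ((n : ℝ) - p)) := by
    rw [← ENNReal.ofReal_mul (by positivity), ← Real.rpow_add hR, add_sub_cancel,
      Real.rpow_natCast]
  have hfin : ENNReal.ofReal (R ^ p) * (volume (A 1) * ENNReal.ofReal (R ^ ((n : ℝ) - p))) ≤
      ENNReal.ofReal (R ^ p) * (K' * ∫⁻ x, f x) := by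
    have := hAR.trans hmain
    rw [hRn, ENNReal.ofReal_mul hK0.le] at this
    calc _ = _ := by ring
      _ ≤ _ := this
      _ = _ := by rw [hK']; ring
  rw [ENNReal.mul_le_mul_iff_right hRp ENNReal.ofReal_ne_top] at hfin
  calc volume (A 1) / K' * ENNReal.ofReal (R ^ ((n : ℝ) - p))
      = volume (A 1) * ENNReal.ofReal (R ^ ((n : ℝ) - p)) / K' := by
        simp only [ENNReal.div_eq_inv_mul]; ring
    _ ≤ _ := ENNReal.div_le_of_le_mul' hfin

lemma varCapCompact_le_varCap {K Ω : Set (Euc n)} (hK : IsCompact K) :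
    varCapCompact n p K Ω ≤ varCap n p K Ω :=
  le_iInf₂ fun _ hG => le_iSup₂ (f := fun K' _ => varCapCompact n p K' Ω) K ⟨hK, hG.2.1⟩

end Sphere

/-! ### Slowly growing weights for summable series -/

lemma ENNReal.exists_tendsto_atTop_tsum_mul_ne_top (v : ℕ → ℝ≥0∞) (hv : ∑' i, v i ≠ ⊤) :
    ∃ τ : ℕ → ℕ, Tendsto τ atTop atTop ∧ ∑' i, (τ i : ℝ≥0∞) * v i ≠ ⊤ := by
  have htail : Tendsto (fun N => ∑' i, v (i + N)) atTop (𝓝 0) := ENNReal.tendsto_sum_nat_add v hv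
  have hex : ∀ k : ℕ, ∃ N, k ≤ N ∧ ∑' i, v (i + N) ≤ 2⁻¹ ^ k := fun k => by
    have h1 := htail.eventually_le_const
      (show (0 : ℝ≥0∞) < 2⁻¹ ^ k from ENNReal.pow_pos (by simp) k)
    obtain ⟨N, hN⟩ := (h1.and (eventually_ge_atTop k)).exists
    exact ⟨N, hN.2, hN.1⟩
  choose N hkN hN using hex
  set s : ℕ → Finset ℕ := fun i => (Finset.range (i + 1)).filter fun k => N k ≤ i with hs
  have hmem : ∀ i k, k ∈ s i ↔ N k ≤ i := by
    intro i k
    simp only [hs, Finset.mem_filter, Finset.mem_range, and_iff_right_iff_imp]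
    intro h
    have := hkN k
    omega
  refine ⟨fun i => 1 + (s i).card, ?_, ?_⟩
  · refine tendsto_atTop.2 fun M => ?_
    filter_upwards [eventually_ge_atTop ((Finset.range M).sup N)] with i hi
    have : Finset.range M ⊆ s i := fun k hk => (hmem i k).2 ((Finset.le_sup hk).trans hi)
    have := Finset.card_le_card this
    rw [Finset.card_range] at this
    omega
  · have h1 : ∀ i, ((1 + (s i).card : ℕ) : ℝ≥0∞) * v i =
        v i + ∑' k, if N k ≤ i then v i else 0 := by
      intro i
      rw [tsum_eq_sum (s := s i) fun k hk => by
        rw [hmem] at hk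
        simp [hk], Finset.sum_congr rfl (g := fun _ => v i) fun k hk => by
        simp [(hmem i k).1 hk]]
      rw [Finset.sum_const, nsmul_eq_mul]
      push_cast
      ring
    have h2 : ∀ k, ∑' i, (if N k ≤ i then v i else 0) = ∑' i, v (i + N k) := by
      intro k
      have h3 := Summable.sum_add_tsum_nat_add' (f := fun i => if N k ≤ i then v i else 0) (k := N k)
        ENNReal.summable
      rw [Finset.sum_eq_zero fun i hi => if_neg (by simpa using hi), zero_add] at h3
      rw [← h3]
      simp
    simp_rw [h1]
    rw [ENNReal.tsum_add, ENNReal.tsum_comm]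
    simp_rw [h2]
    refine ENNReal.add_ne_top.2 ⟨hv, ((ENNReal.tsum_le_tsum hN).trans_lt ?_).ne⟩
    rw [ENNReal.tsum_geometric, ENNReal.one_sub_inv_two, inv_inv]
    exact ENNReal.ofNat_lt_top

/-! ### Estimates for pieces of the Wolff potential -/

section Pieces

variable {n : ℕ} {p : ℝ}

lemma wolffDensity_mul_ofReal_inv (hp₁ : 1 < p) {m : Measure (Euc n)} {x : Euc n} {t : ℝ}
    (ht : 0 < t) : wolffDensity n p m t x * ENNReal.ofReal t⁻¹ =
      m (ball x t) ^ (1 / (p - 1)) * ENNReal.ofReal (t ^ (-(((n : ℝ) - p) / (p - 1)) - 1)) := by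
  have hα : 0 ≤ 1 / (p - 1) := one_div_nonneg.2 (by linarith)
  have h1 : (t ^ ((n : ℝ) - p)) ^ (1 / (p - 1)) = t ^ (((n : ℝ) - p) / (p - 1)) := by
    rw [← Real.rpow_mul ht.le, mul_one_div]
  rw [wolffDensity, ENNReal.div_rpow_of_nonneg _ _ hα,
    ENNReal.ofReal_rpow_of_nonneg (by positivity) hα, h1, div_eq_mul_inv,
    ← ENNReal.ofReal_inv_of_pos (by positivity), mul_assoc,
    ← ENNReal.ofReal_mul (by positivity), ← Real.rpow_neg ht.le, Real.rpow_sub_one ht.ne',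
    div_eq_mul_inv (t ^ _)]

lemma lintegral_Ici_rpow {b a : ℝ} (hb : 0 < b) (ha : 0 < a) :
    ∫⁻ t in Ici a, ENNReal.ofReal (t ^ (-b - 1)) = ENNReal.ofReal (a ^ (-b) / b) := by
  rw [setLIntegral_congr Ioi_ae_eq_Ici.symm, ← ofReal_integral_eq_lintegral_ofReal
    (integrableOn_Ioi_rpow_of_lt (by linarith) ha), integral_Ioi_rpow_of_lt (by linarith) ha]
  · congr 1
    rw [sub_add_cancel, div_neg, neg_div, neg_neg]
  · filter_upwards [ae_restrict_mem measurableSet_Ioi] with t ht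
    exact Real.rpow_nonneg (ha.le.trans (le_of_lt ht)) _

lemma setLIntegral_wolffDensity_le (hp₁ : 1 < p) (hp₂ : p < n) {m : Measure (Euc n)} {x : Euc n}
    {a : ℝ} (ha : 0 < a) {S : Set ℝ} (hS : MeasurableSet S) (hSa : S ⊆ Ici a) {M : ℝ≥0∞}
    (hM : ∀ t ∈ S, m (ball x t) ≤ M) :
    ∫⁻ t in S, wolffDensity n p m t x * ENNReal.ofReal t⁻¹ ≤
      M ^ (1 / (p - 1)) *
        ENNReal.ofReal (a ^ (-(((n : ℝ) - p) / (p - 1))) / (((n : ℝ) - p) / (p - 1))) := by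
  have hα : 0 ≤ 1 / (p - 1) := one_div_nonneg.2 (by linarith)
  have hβ : 0 < ((n : ℝ) - p) / (p - 1) := div_pos (by linarith) (by linarith)
  rw [← lintegral_Ici_rpow hβ ha]
  calc ∫⁻ t in S, wolffDensity n p m t x * ENNReal.ofReal t⁻¹
      ≤ ∫⁻ t in S, M ^ (1 / (p - 1)) *
          ENNReal.ofReal (t ^ (-(((n : ℝ) - p) / (p - 1)) - 1)) := by
        refine setLIntegral_mono' hS fun t ht => ?_
        rw [wolffDensity_mul_ofReal_inv hp₁ (ha.trans_le (hSa ht))]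
        gcongr
        exact hM t ht
    _ ≤ ∫⁻ t in Ici a, M ^ (1 / (p - 1)) *
          ENNReal.ofReal (t ^ (-(((n : ℝ) - p) / (p - 1)) - 1)) := lintegral_mono_set hSa
    _ = _ := lintegral_const_mul _ (by fun_prop)

lemma le_setLIntegral_Ioo_wolffDensity (hp₁ : 1 < p) (hp₂ : p < n) {m : Measure (Euc n)}
    {x : Euc n} {a b : ℝ} (ha : 0 < a) (hab : a ≤ b) {M : ℝ≥0∞}
    (hM : ∀ t ∈ Ioo a b, M ≤ m (ball x t)) :
    M ^ (1 / (p - 1)) * ENNReal.ofReal ((a ^ (-(((n : ℝ) - p) / (p - 1))) -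
        b ^ (-(((n : ℝ) - p) / (p - 1)))) / (((n : ℝ) - p) / (p - 1))) ≤
      ∫⁻ t in Ioo a b, wolffDensity n p m t x * ENNReal.ofReal t⁻¹ := by
  have hα : 0 ≤ 1 / (p - 1) := one_div_nonneg.2 (by linarith)
  set β : ℝ := ((n : ℝ) - p) / (p - 1) with hβ'
  have hβ : 0 < β := div_pos (by linarith) (by linarith)
  have h0 : (0 : ℝ) ∉ uIcc a b := by
    rw [uIcc_of_le hab]
    exact fun h => absurd h.1 (not_le.2 ha)
  have hintegral : ENNReal.ofReal ((a ^ (-β) - b ^ (-β)) / β) =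
      ∫⁻ t in Ioo a b, ENNReal.ofReal (t ^ (-β - 1)) := by
    rw [setLIntegral_congr Ioo_ae_eq_Ioc, ← ofReal_integral_eq_lintegral_ofReal
      (intervalIntegral.intervalIntegrable_rpow (Or.inr h0)).1,
      ← intervalIntegral.integral_of_le hab, integral_rpow (Or.inr ⟨by linarith, h0⟩)]
    · congr 1
      rw [sub_add_cancel, div_neg]
      ring
    · filter_upwards [ae_restrict_mem measurableSet_Ioc] with t ht
      exact Real.rpow_nonneg (ha.le.trans ht.1.le) _
  rw [hintegral, ← lintegral_const_mul _ (by fun_prop)]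
  refine setLIntegral_mono' measurableSet_Ioo fun t ht => ?_
  rw [wolffDensity_mul_ofReal_inv hp₁ (ha.trans ht.1)]
  gcongr
  exact hM t ht

lemma lintegral_wolffDensity_le_tsum (hp₁ : 1 < p) (hp₂ : p < n) (m : Measure (Euc n))
    (x : Euc n) {ρ : ℝ} (hρ : 0 < ρ) :
    ∫⁻ t in Ioo 0 ρ, wolffDensity n p m t x * ENNReal.ofReal t⁻¹ ≤
      ENNReal.ofReal (doublingConst n p) * ∑' j : ℕ, wolffDensity n p m (ρ / 2 ^ j) x := by
  have hcover : Ioo 0 ρ ⊆ ⋃ j : ℕ, Ioc (ρ / 2 ^ (j + 1)) (ρ / 2 ^ j) := by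
    rintro t ⟨ht0, htρ⟩
    obtain ⟨j, hj₁, hj₂⟩ := exists_nat_pow_near_of_lt_one (div_pos ht0 hρ)
      ((div_le_one hρ).2 htρ.le) (show (0 : ℝ) < 2⁻¹ by norm_num) (by norm_num)
    rw [lt_div_iff₀ hρ] at hj₁
    rw [div_le_iff₀ hρ] at hj₂
    rw [mem_iUnion]
    refine ⟨j, ?_, ?_⟩
    · rwa [div_eq_inv_mul, ← inv_pow]
    · rwa [div_eq_inv_mul, ← inv_pow]
  refine (lintegral_mono_set hcover).trans ((lintegral_iUnion_le _ _).trans ?_)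
  rw [← ENNReal.tsum_mul_left]
  refine ENNReal.tsum_le_tsum fun j => ?_
  have ha : 0 < ρ / 2 ^ (j + 1) := by positivity
  have hab : ρ / 2 ^ j = 2 * (ρ / 2 ^ (j + 1)) := by
    rw [pow_succ]
    field_simp
  rw [hab]
  set a := ρ / 2 ^ (j + 1)
  calc ∫⁻ t in Ioc a (2 * a), wolffDensity n p m t x * ENNReal.ofReal t⁻¹
      ≤ ∫⁻ t in Ioc a (2 * a), ENNReal.ofReal (doublingConst n p) *
          wolffDensity n p m (2 * a) x * ENNReal.ofReal a⁻¹ := by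
        refine setLIntegral_mono' measurableSet_Ioc fun t ht => ?_
        gcongr
        · exact wolffDensity_le hp₁ hp₂ (ha.trans ht.1) (by positivity) (by linarith [ht.1])
            (ball_subset_ball ht.2)
        · exact ht.1.le
    _ = ENNReal.ofReal (doublingConst n p) * wolffDensity n p m (2 * a) x := by
        rw [setLIntegral_const, Real.volume_Ioc, mul_assoc, ← ENNReal.ofReal_mul (by positivity)]
        rw [two_mul, add_sub_cancel_left, inv_mul_cancel₀ ha.ne', ENNReal.ofReal_one, mul_one]

/-- The annulus containing all small balls centred in `{R ≤ ‖x - x₀‖ ≤ 2 * R}`. -/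
def fatAnnulus (x₀ : Euc n) (R : ℝ) : Set (Euc n) :=
  {y | 3 / 4 * R < ‖y - x₀‖ ∧ ‖y - x₀‖ < 3 * R}

lemma measurableSet_fatAnnulus (x₀ : Euc n) (R : ℝ) : MeasurableSet (fatAnnulus x₀ R) :=
  measurableSet_Ioo.preimage (f := fun y => ‖y - x₀‖) (by fun_prop)

lemma ball_subset_fatAnnulus {x₀ x : Euc n} {R t : ℝ} (h₁ : R ≤ ‖x - x₀‖)
    (h₂ : ‖x - x₀‖ ≤ 2 * R) (ht : t ≤ R / 32) : ball x t ⊆ fatAnnulus x₀ R := by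
  intro y hy
  rw [mem_ball, dist_eq_norm] at hy
  have h3 : ‖y - x₀‖ ≤ ‖y - x‖ + ‖x - x₀‖ := by simpa using norm_add_le (y - x) (x - x₀)
  have h4 : ‖x - x₀‖ ≤ ‖y - x‖ + ‖y - x₀‖ := by
    rw [norm_sub_rev y x]
    simpa using norm_add_le (x - y) (y - x₀)
  exact ⟨by linarith [norm_nonneg (y - x)], by linarith [norm_nonneg (y - x)]⟩

lemma lintegral_wolffDensity_le_of_notMem_superlevelSet (hp₁ : 1 < p) (hp₂ : p < n)
    (μ : Measure (Euc n)) {x₀ x : Euc n} {R : ℝ} (hR : 0 < R) (h₁ : R ≤ ‖x - x₀‖)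
    (h₂ : ‖x - x₀‖ ≤ 2 * R) (κ : ℝ≥0∞)
    (hx : x ∉ superlevelSet n p (κ • μ.restrict (fatAnnulus x₀ R)) (R / 2)) :
    κ ^ (1 / (p - 1)) * ∫⁻ t in Ioo 0 (R / 32), wolffDensity n p μ t x * ENNReal.ofReal t⁻¹ ≤
      ENNReal.ofReal (doublingConst n p) := by
  have hα : 0 ≤ 1 / (p - 1) := one_div_nonneg.2 (by linarith)
  set m := κ • μ.restrict (fatAnnulus x₀ R) with hm
  have hdens : ∀ t ∈ Ioo 0 (R / 32), κ ^ (1 / (p - 1)) *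
      (wolffDensity n p μ t x * ENNReal.ofReal t⁻¹) =
        wolffDensity n p m t x * ENNReal.ofReal t⁻¹ := by
    intro t ht
    rw [wolffDensity, wolffDensity, hm, Measure.smul_apply,
      Measure.restrict_apply measurableSet_ball,
      inter_eq_left.2 (ball_subset_fatAnnulus h₁ h₂ ht.2.le), smul_eq_mul, mul_div_assoc,
      ENNReal.mul_rpow_of_nonneg _ _ hα, mul_assoc]
  have hsum : ∀ N, ∑ j ∈ Finset.range N, truncDensity n p m (R / 2 / 2 ^ (j + 4)) x ≤ 1 := by
    intro N
    by_contra h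
    exact hx (mem_iUnion.2 ⟨N, fun h' => h (by simpa only [sublevelSet, mem_ofPred_eq] using h')⟩)
  have htrunc : ∀ j, truncDensity n p m (R / 2 / 2 ^ (j + 4)) x =
      wolffDensity n p m (R / 32 / 2 ^ j) x := by
    intro j
    have h1 : truncDensity n p m (R / 2 / 2 ^ (j + 4)) x ≤ 1 :=
      (Finset.single_le_sum (f := fun j => truncDensity n p m (R / 2 / 2 ^ (j + 4)) x)
        (fun _ _ => bot_le) (Finset.self_mem_range_succ j)).trans (hsum (j + 1))
    have h2 : R / 2 / 2 ^ (j + 4) = R / 32 / 2 ^ j := by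
      rw [pow_add]
      field_simp
      norm_num
    rw [truncDensity] at h1 ⊢
    rw [h2] at h1 ⊢
    refine min_eq_right ?_
    rcases min_le_iff.1 h1 with h | h
    · exact absurd h (by norm_num)
    · exact h.trans (by norm_num)
  calc κ ^ (1 / (p - 1)) * ∫⁻ t in Ioo 0 (R / 32), wolffDensity n p μ t x * ENNReal.ofReal t⁻¹
      ≤ ∫⁻ t in Ioo 0 (R / 32), κ ^ (1 / (p - 1)) *
          (wolffDensity n p μ t x * ENNReal.ofReal t⁻¹) := lintegral_const_mul_le _ _
    _ = ∫⁻ t in Ioo 0 (R / 32), wolffDensity n p m t x * ENNReal.ofReal t⁻¹ :=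
        setLIntegral_congr_fun measurableSet_Ioo hdens
    _ ≤ ENNReal.ofReal (doublingConst n p) * ∑' j : ℕ, wolffDensity n p m (R / 32 / 2 ^ j) x :=
        lintegral_wolffDensity_le_tsum hp₁ hp₂ m x (by positivity)
    _ ≤ ENNReal.ofReal (doublingConst n p) * 1 := by
        gcongr
        simp_rw [← htrunc]
        exact ENNReal.tsum_le_of_sum_range_le hsum
    _ = _ := mul_one _

lemma disjoint_fatAnnulus (x₀ : Euc n) {R R' : ℝ} (h : 4 * R' ≤ R) :
    Disjoint (fatAnnulus x₀ R) (fatAnnulus x₀ R') :=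
  Set.disjoint_left.2 fun y h₁ h₂ => by linarith [h₁.1, h₂.2]

lemma tsum_measure_fatAnnulus_ne_top (μ : Measure (Euc n)) [IsFiniteMeasure μ] (x₀ : Euc n) :
    ∑' i : ℕ, μ (fatAnnulus x₀ ((2 : ℝ) ^ (-(i : ℤ) - 1))) ≠ ⊤ := by
  have key : ∀ φ : ℕ → ℕ, (∀ k l, k < l → φ k + 2 ≤ φ l) →
      ∑' k : ℕ, μ (fatAnnulus x₀ ((2 : ℝ) ^ (-(φ k : ℤ) - 1))) ≤ μ univ := by
    intro φ hφ
    have hlt : ∀ k l, k < l → Disjoint (fatAnnulus x₀ ((2 : ℝ) ^ (-(φ k : ℤ) - 1)))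
        (fatAnnulus x₀ ((2 : ℝ) ^ (-(φ l : ℤ) - 1))) := by
      intro k l hkl
      refine disjoint_fatAnnulus x₀ ?_
      calc 4 * (2 : ℝ) ^ (-(φ l : ℤ) - 1) = 2 ^ (-(φ l : ℤ) - 1 + 2) := by
            rw [zpow_add₀ two_ne_zero, mul_comm]
            norm_num
        _ ≤ _ := by
            refine zpow_le_zpow_right₀ one_le_two ?_
            have := hφ k l hkl
            omega
    rw [← measure_iUnion (fun k l hkl => ?_) fun k => measurableSet_fatAnnulus _ _]
    · exact measure_mono (subset_univ _)
    · rcases lt_or_gt_of_ne hkl with h | h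
      · exact hlt k l h
      · exact (hlt l k h).symm
  have h := tsum_even_add_odd (f := fun i : ℕ => μ (fatAnnulus x₀ ((2 : ℝ) ^ (-(i : ℤ) - 1))))
    ENNReal.summable ENNReal.summable
  rw [← h]
  exact ENNReal.add_ne_top.2
    ⟨((key (fun k => 2 * k) fun k l hkl => by omega).trans_lt (measure_lt_top μ _)).ne,
      ((key (fun k => 2 * k + 1) fun k l hkl => by omega).trans_lt (measure_lt_top μ _)).ne⟩

end Pieces

/-! ### Thinness and the limit -/

section Limit

variable {n : ℕ} {p : ℝ}

/-- The points which, for each dyadic annulus of inner radius `R i = 2 ^ (-i - 1)` containing them,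
lie in the superlevel set of the measure `(τ i * R i ^ (n - p)) • μ` restricted to a neighbourhood
of that annulus. -/
def exceptionalSet (n : ℕ) (p : ℝ) (μ : Measure (Euc n)) (x₀ : Euc n) (τ : ℕ → ℕ) :
    Set (Euc n) :=
  {x | ∀ i : ℕ, x ∈ wAnn n (i + 1) x₀ →
    x ∈ superlevelSet n p (((τ i : ℝ≥0∞) *
      ENNReal.ofReal (((2 : ℝ) ^ (-(i : ℤ) - 1)) ^ ((n : ℝ) - p))) •
        μ.restrict (fatAnnulus x₀ ((2 : ℝ) ^ (-(i : ℤ) - 1)))) ((2 : ℝ) ^ (-(i : ℤ) - 1) / 2)}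

lemma two_zpow_neg_succ (i : ℕ) : (2 : ℝ) ^ (-((i + 1 : ℕ) : ℤ)) = 2 ^ (-(i : ℤ) - 1) := by
  congr 1
  push_cast
  ring

lemma pThinAt_exceptionalSet (hp₁ : 1 < p) (hp₂ : p < n) (μ : Measure (Euc n))
    [IsFiniteMeasure μ] (x₀ : Euc n) {τ : ℕ → ℕ}
    (hτ : ∑' i : ℕ, (τ i : ℝ≥0∞) * μ (fatAnnulus x₀ ((2 : ℝ) ^ (-(i : ℤ) - 1))) ≠ ⊤) :
    pThinAt n p (exceptionalSet n p μ x₀ τ) x₀ := by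
  obtain ⟨C, hC, hcap⟩ := exists_varCap_superlevelSet_le hp₁ hp₂
  obtain ⟨c, hc, hsphere⟩ := exists_le_varCapCompact_sphere hp₁ hp₂
  rw [pThinAt, if_pos hp₂]
  refine lt_of_le_of_lt (b := ∑' i : ℕ, C / c *
    ((τ i : ℝ≥0∞) * μ (fatAnnulus x₀ ((2 : ℝ) ^ (-(i : ℤ) - 1))))) ?_ ?_
  swap
  · rw [ENNReal.tsum_mul_left]
    exact ENNReal.mul_lt_top (ENNReal.div_lt_top hC hc) (lt_top_iff_ne_top.2 hτ)
  refine ENNReal.tsum_le_tsum fun i => ?_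
  set R : ℝ := (2 : ℝ) ^ (-(i : ℤ) - 1) with hR
  have hR0 : 0 < R := by positivity
  have h2R : (2 : ℝ) ^ (-(i : ℤ)) = 2 * R := by
    rw [hR, zpow_sub_one₀ two_ne_zero]
    ring
  set κ : ℝ≥0∞ := (τ i : ℝ≥0∞) * ENNReal.ofReal (R ^ ((n : ℝ) - p)) with hκ
  have hκt : κ ≠ ⊤ := ENNReal.mul_ne_top (by simp) ENNReal.ofReal_ne_top
  set m : Measure (Euc n) := κ • μ.restrict (fatAnnulus x₀ R) with hm
  have hmu : m univ = κ * μ (fatAnnulus x₀ R) := by simp [hm]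
  have : IsFiniteMeasure m := ⟨by
    rw [hmu]
    exact ENNReal.mul_lt_top (lt_top_iff_ne_top.2 hκt) (measure_lt_top μ _)⟩
  have hmc : m {y | 3 / 4 * R < ‖y - x₀‖ ∧ ‖y - x₀‖ < 3 * R}ᶜ = 0 := by
    change m (fatAnnulus x₀ R)ᶜ = 0
    rw [hm, Measure.smul_apply, Measure.restrict_apply (measurableSet_fatAnnulus x₀ R).compl,
      compl_inter_self, measure_empty, smul_zero]
  have hnum := hcap m x₀ (i + 1) R (two_zpow_neg_succ i).symm hmc
    (exceptionalSet n p μ x₀ τ ∩ wAnn n (i + 1) x₀) fun x hx => hx.1 i hx.2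
  rw [inter_assoc, inter_self, hmu] at hnum
  have hden := (hsphere x₀ R hR0).trans (varCapCompact_le_varCap (isCompact_sphere x₀ R))
  rw [h2R]
  have hRt : ENNReal.ofReal (R ^ ((n : ℝ) - p)) ≠ 0 := by
    rw [Ne, ENNReal.ofReal_eq_zero, not_le]
    positivity
  calc _ ≤ C * (κ * μ (fatAnnulus x₀ R)) / (c * ENNReal.ofReal (R ^ ((n : ℝ) - p))) :=
        ENNReal.div_le_div hnum hden
    _ = C * (τ i * μ (fatAnnulus x₀ R)) * ENNReal.ofReal (R ^ ((n : ℝ) - p)) /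
          (c * ENNReal.ofReal (R ^ ((n : ℝ) - p))) := by
        rw [hκ]
        ring_nf
    _ = C * (τ i * μ (fatAnnulus x₀ R)) / c :=
        ENNReal.mul_div_mul_right _ _ hRt ENNReal.ofReal_ne_top
    _ = _ := by
        simp only [ENNReal.div_eq_inv_mul]
        ring

lemma tendsto_near_part (hp₁ : 1 < p) (hp₂ : p < n) (μ : Measure (Euc n)) (x₀ : Euc n)
    {τ : ℕ → ℕ} (hτ : Tendsto τ atTop atTop) :
    Tendsto (fun x => ENNReal.ofReal (‖x - x₀‖ ^ (((n : ℝ) - p) / (p - 1))) *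
        ∫⁻ t in Ioo 0 (‖x - x₀‖ / 64), wolffDensity n p μ t x * ENNReal.ofReal t⁻¹)
      (𝓝[(exceptionalSet n p μ x₀ τ)ᶜ \ {x₀}] x₀) (𝓝 0) := by
  have hα : 0 < 1 / (p - 1) := one_div_pos.2 (by linarith)
  set β : ℝ := ((n : ℝ) - p) / (p - 1) with hβ'
  have hβ : 0 < β := div_pos (by linarith) (by linarith)
  set K : ℝ≥0∞ := ENNReal.ofReal (2 ^ β) * ENNReal.ofReal (doublingConst n p) with hK
  have hKt : K ≠ ⊤ := ENNReal.mul_ne_top ENNReal.ofReal_ne_top ENNReal.ofReal_ne_top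
  have hlim : Tendsto (fun i => K * (((τ i : ℝ≥0∞) ^ (1 / (p - 1)))⁻¹)) atTop (𝓝 0) := by
    have h1 : Tendsto (fun i => ((τ i : ℝ≥0∞) ^ (1 / (p - 1)))⁻¹) atTop (𝓝 0) := by
      rw [← ENNReal.inv_top, tendsto_inv_iff]
      have h2 := (ENNReal.tendsto_nat_nhds_top.comp hτ).ennrpow_const (1 / (p - 1))
      rwa [ENNReal.top_rpow_of_pos hα] at h2
    simpa using ENNReal.Tendsto.const_mul h1 (Or.inr hKt)
  refine ENNReal.tendsto_nhds_zero.2 fun ε hε => ?_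
  obtain ⟨I, hI⟩ := eventually_atTop.1
    ((ENNReal.tendsto_nhds_zero.1 hlim ε hε).and (hτ.eventually_ge_atTop 1))
  have hball : ball x₀ ((2 : ℝ) ^ (-(I : ℤ) - 1)) ∈ 𝓝 x₀ := ball_mem_nhds _ (by positivity)
  filter_upwards [mem_nhdsWithin_of_mem_nhds hball, self_mem_nhdsWithin] with x hxI hx
  have hxE : ∃ i : ℕ, x ∈ wAnn n (i + 1) x₀ ∧ x ∉ superlevelSet n p (((τ i : ℝ≥0∞) *
      ENNReal.ofReal (((2 : ℝ) ^ (-(i : ℤ) - 1)) ^ ((n : ℝ) - p))) •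
        μ.restrict (fatAnnulus x₀ ((2 : ℝ) ^ (-(i : ℤ) - 1))))
          ((2 : ℝ) ^ (-(i : ℤ) - 1) / 2) := by
    by_contra! h
    exact hx.1 h
  obtain ⟨i, hi, hiE⟩ := hxE
  rw [mem_wAnn_iff, two_zpow_neg_succ] at hi
  rw [mem_ball, dist_eq_norm] at hxI
  have hIi : I ≤ i := by
    have h1 := (zpow_lt_zpow_iff_right₀ (one_lt_two (α := ℝ))).1 (hi.1.trans_lt hxI)
    omega
  obtain ⟨hε', hτ1⟩ := hI i hIi
  refine le_trans ?_ hε'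
  set R : ℝ := (2 : ℝ) ^ (-(i : ℤ) - 1) with hR
  have hR0 : 0 < R := by positivity
  have hest := lintegral_wolffDensity_le_of_notMem_superlevelSet hp₁ hp₂ μ hR0 hi.1 hi.2 _ hiE
  have hRβ : (R ^ ((n : ℝ) - p)) ^ (1 / (p - 1)) = R ^ β := by
    rw [← Real.rpow_mul hR0.le, mul_one_div]
  rw [ENNReal.mul_rpow_of_nonneg _ _ hα.le, ENNReal.ofReal_rpow_of_nonneg (by positivity) hα.le,
    hRβ] at hest
  set T : ℝ≥0∞ := (τ i : ℝ≥0∞) ^ (1 / (p - 1)) with hT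
  have hT0 : T ≠ 0 := by
    rw [hT, Ne, ENNReal.rpow_eq_zero_iff_of_pos hα]
    simp only [Nat.cast_eq_zero]
    omega
  have hTt : T ≠ ⊤ := ENNReal.rpow_ne_top_of_nonneg hα.le (by simp)
  set J := ∫⁻ t in Ioo 0 (R / 32), wolffDensity n p μ t x * ENNReal.ofReal t⁻¹ with hJ
  calc ENNReal.ofReal (‖x - x₀‖ ^ β) *
        ∫⁻ t in Ioo 0 (‖x - x₀‖ / 64), wolffDensity n p μ t x * ENNReal.ofReal t⁻¹
      ≤ ENNReal.ofReal ((2 * R) ^ β) * J := by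
        gcongr
        · exact hi.2
        · exact lintegral_mono_set (Ioo_subset_Ioo_right (by linarith [hi.2]))
    _ = ENNReal.ofReal (2 ^ β) * (ENNReal.ofReal (R ^ β) * J) := by
        rw [Real.mul_rpow two_pos.le hR0.le, ENNReal.ofReal_mul (by positivity), mul_assoc]
    _ ≤ ENNReal.ofReal (2 ^ β) * (ENNReal.ofReal (doublingConst n p) / T) := by
        gcongr
        rw [ENNReal.le_div_iff_mul_le (Or.inl hT0) (Or.inl hTt)]
        calc _ = _ := by ring
          _ ≤ _ := hest
    _ = _ := by rw [hK, div_eq_mul_inv, mul_assoc]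

end Limit

section Main

variable {n : ℕ} {p : ℝ}

lemma tendsto_measure_ball_diff (μ : Measure (Euc n)) [IsFiniteMeasure μ] (x₀ : Euc n) :
    Tendsto (fun s : ℝ => μ (ball x₀ (2 * s) \ {x₀})) (𝓝[>] 0) (𝓝 0) := by
  have h := tendsto_measure_biInter_gt (μ := μ) (s := fun s : ℝ => ball x₀ (2 * s) \ {x₀}) (a := 0)
    (fun r _ => (measurableSet_ball.diff (measurableSet_singleton _)).nullMeasurableSet)
    (fun i j _ hij => sdiff_subset_sdiff_left (ball_subset_ball (by linarith)))
    ⟨1, one_pos, measure_ne_top _ _⟩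
  have h0 : ⋂ r > (0 : ℝ), ball x₀ (2 * r) \ {x₀} = ∅ := by
    refine eq_empty_of_forall_notMem fun y hy => ?_
    rw [mem_iInter₂] at hy
    have hy0 : 0 < dist y x₀ := dist_pos.2 (hy 1 one_pos).2
    have := (hy (dist y x₀ / 2) (by positivity)).1
    rw [mem_ball] at this
    linarith
  rw [h0, measure_empty] at h
  exact h

lemma tendsto_measure_ball_singleton (μ : Measure (Euc n)) [IsFiniteMeasure μ] (x₀ : Euc n) :
    Tendsto (fun s : ℝ => μ (ball x₀ (2 * s))) (𝓝[>] 0) (𝓝 (μ {x₀})) := by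
  have h := tendsto_measure_biInter_gt (μ := μ) (s := fun s : ℝ => ball x₀ (2 * s)) (a := 0)
    (fun r _ => measurableSet_ball.nullMeasurableSet)
    (fun i j _ hij => ball_subset_ball (by linarith))
    ⟨1, one_pos, measure_ne_top _ _⟩
  have h0 : ⋂ r > (0 : ℝ), ball x₀ (2 * r) = {x₀} := by
    ext y
    rw [mem_iInter₂, mem_singleton_iff]
    constructor
    · intro hy
      by_contra hne
      have hy0 : 0 < dist y x₀ := dist_pos.2 hne
      have := hy (dist y x₀ / 2) (by positivity)
      rw [mem_ball] at this
      linarith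
    · rintro rfl r hr
      have hr' : (0 : ℝ) < r := hr
      exact mem_ball_self (by positivity)
  rw [h0] at h
  exact h

lemma wolffPotential_le (hp₁ : 1 < p) (hp₂ : p < n) (μ : Measure (Euc n)) {x₀ x : Euc n}
    {d : ℝ} (r : ℝ) (hd : d = ‖x - x₀‖) (hd₀ : 0 < d) (hd₁ : d ≤ 1) :
    ENNReal.ofReal (d ^ (((n : ℝ) - p) / (p - 1))) * wolffPotential n p μ x r ≤
      ENNReal.ofReal (d ^ (((n : ℝ) - p) / (p - 1))) *
          (∫⁻ t in Ioo 0 (d / 64), wolffDensity n p μ t x * ENNReal.ofReal t⁻¹) +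
        μ (ball x₀ (2 * d) \ {x₀}) ^ (1 / (p - 1)) *
          ENNReal.ofReal (64 ^ (((n : ℝ) - p) / (p - 1)) / (((n : ℝ) - p) / (p - 1))) +
        μ (ball x₀ (2 * √d)) ^ (1 / (p - 1)) * ENNReal.ofReal ((((n : ℝ) - p) / (p - 1))⁻¹) +
        μ univ ^ (1 / (p - 1)) *
          ENNReal.ofReal (√d ^ (((n : ℝ) - p) / (p - 1)) / (((n : ℝ) - p) / (p - 1))) := by
  set β : ℝ := ((n : ℝ) - p) / (p - 1) with hβ'
  have hβ : 0 < β := div_pos (by linarith) (by linarith)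
  have hs0 : 0 < √d := Real.sqrt_pos.2 hd₀
  have hds : d ≤ √d := Real.le_sqrt_of_sq_le (by nlinarith)
  have hcover : Ioo 0 r ⊆ ((Ioo 0 (d / 64) ∪ Ico (d / 64) d) ∪ Ico d √d) ∪ Ici √d := by
    rintro t ⟨ht, -⟩
    rcases lt_or_ge t √d with h1 | h1
    · rcases lt_or_ge t d with h2 | h2
      · rcases lt_or_ge t (d / 64) with h3 | h3
        · exact Or.inl (Or.inl (Or.inl ⟨ht, h3⟩))
        · exact Or.inl (Or.inl (Or.inr ⟨h3, h2⟩))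
      · exact Or.inl (Or.inr ⟨h2, h1⟩)
    · exact Or.inr h1
  have hball : ∀ t, ball x t ⊆ ball x₀ (t + d) := fun t =>
    ball_subset_ball' (by rw [dist_eq_norm, hd])
  have h2 := setLIntegral_wolffDensity_le hp₁ hp₂ (m := μ) (x := x) (a := d / 64) (by positivity)
    measurableSet_Ico (S := Ico (d / 64) d) (fun t ht => ht.1)
    (M := μ (ball x₀ (2 * d) \ {x₀})) fun t ht => by
      refine measure_mono fun y hy => ⟨?_, ?_⟩
      · exact ball_subset_ball (by linarith [ht.2]) (hball t hy)
      · rintro rfl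
        rw [mem_ball, dist_comm, dist_eq_norm, ← hd] at hy
        exact absurd ht.2 (not_lt.2 hy.le)
  have h3 := setLIntegral_wolffDensity_le hp₁ hp₂ (m := μ) (x := x) (a := d) hd₀
    measurableSet_Ico (S := Ico d √d) (fun t ht => ht.1)
    (M := μ (ball x₀ (2 * √d))) fun t ht =>
      measure_mono ((hball t).trans (ball_subset_ball (by linarith [ht.2])))
  have h4 := setLIntegral_wolffDensity_le hp₁ hp₂ (m := μ) (x := x) (a := √d) hs0
    measurableSet_Ici (S := Ici √d) le_rfl
    (M := μ univ) fun t _ => measure_mono (subset_univ _)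
  rw [← hβ'] at h2 h3 h4
  have hW : wolffPotential n p μ x r ≤
      (∫⁻ t in Ioo 0 (d / 64), wolffDensity n p μ t x * ENNReal.ofReal t⁻¹) +
        (∫⁻ t in Ico (d / 64) d, wolffDensity n p μ t x * ENNReal.ofReal t⁻¹) +
        (∫⁻ t in Ico d √d, wolffDensity n p μ t x * ENNReal.ofReal t⁻¹) +
        ∫⁻ t in Ici √d, wolffDensity n p μ t x * ENNReal.ofReal t⁻¹ := by
    change ∫⁻ t in Ioo 0 r, wolffDensity n p μ t x * ENNReal.ofReal t⁻¹ ≤ _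
    refine (lintegral_mono_set hcover).trans ((lintegral_union_le _ _ _).trans ?_)
    gcongr
    refine (lintegral_union_le _ _ _).trans ?_
    gcongr
    exact lintegral_union_le _ _ _
  have hcomb : ∀ (M : ℝ≥0∞) (a e : ℝ), d ^ β * (a ^ (-β) / β) = e →
      ENNReal.ofReal (d ^ β) * (M * ENNReal.ofReal (a ^ (-β) / β)) = M * ENNReal.ofReal e := by
    rintro M a e rfl
    rw [ENNReal.ofReal_mul (by positivity)]
    ring
  have e2 : d ^ β * ((d / 64) ^ (-β) / β) = 64 ^ β / β := by
    rw [Real.rpow_neg (by positivity), Real.div_rpow hd₀.le (by norm_num)]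
    have := (Real.rpow_pos_of_pos hd₀ β).ne'
    field_simp
  have e3 : d ^ β * (d ^ (-β) / β) = β⁻¹ := by
    rw [Real.rpow_neg (by positivity)]
    have := (Real.rpow_pos_of_pos hd₀ β).ne'
    field_simp
  have e4 : d ^ β * (√d ^ (-β) / β) = √d ^ β / β := by
    have h5 : d ^ β = √d ^ β * √d ^ β := by
      rw [← Real.mul_rpow hs0.le hs0.le, Real.mul_self_sqrt hd₀.le]
    rw [h5, Real.rpow_neg hs0.le]
    have := (Real.rpow_pos_of_pos hs0 β).ne'
    field_simp
  rw [← hcomb _ _ _ e2, ← hcomb _ _ _ e3, ← hcomb _ _ _ e4, ← mul_add, ← mul_add, ← mul_add]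
  gcongr
  exact hW.trans (by gcongr)

lemma le_wolffPotential (hp₁ : 1 < p) (hp₂ : p < n) (μ : Measure (Euc n)) {x₀ x : Euc n}
    {d r : ℝ} (hd : d = ‖x - x₀‖) (hd₀ : 0 < d) (hdr : d ≤ r) :
    μ {x₀} ^ (1 / (p - 1)) * ENNReal.ofReal ((1 - d ^ (((n : ℝ) - p) / (p - 1)) *
        r ^ (-(((n : ℝ) - p) / (p - 1)))) / (((n : ℝ) - p) / (p - 1))) ≤
      ENNReal.ofReal (d ^ (((n : ℝ) - p) / (p - 1))) * wolffPotential n p μ x r := by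
  have h := le_setLIntegral_Ioo_wolffDensity hp₁ hp₂ (m := μ) (x := x) hd₀ hdr (M := μ {x₀})
    fun t ht => measure_mono (by
      rw [singleton_subset_iff, mem_ball, dist_comm, dist_eq_norm, ← hd]
      exact ht.1)
  set β : ℝ := ((n : ℝ) - p) / (p - 1) with hβ'
  have hβ : 0 < β := div_pos (by linarith) (by linarith)
  have hW : (∫⁻ t in Ioo d r, wolffDensity n p μ t x * ENNReal.ofReal t⁻¹) ≤
      wolffPotential n p μ x r := lintegral_mono_set (Ioo_subset_Ioo_left hd₀.le)
  have e : (1 - d ^ β * r ^ (-β)) / β = d ^ β * ((d ^ (-β) - r ^ (-β)) / β) := by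
    rw [Real.rpow_neg hd₀.le]
    have := (Real.rpow_pos_of_pos hd₀ β).ne'
    field_simp
  rw [e, ENNReal.ofReal_mul (by positivity)]
  calc _ = ENNReal.ofReal (d ^ β) *
        (μ {x₀} ^ (1 / (p - 1)) * ENNReal.ofReal ((d ^ (-β) - r ^ (-β)) / β)) := by ring
    _ ≤ _ := by
        gcongr
        exact h.trans hW

lemma tendsto_wolffPotential (hp₁ : 1 < p) (hp₂ : p < n) (μ : Measure (Euc n))
    [IsFiniteMeasure μ] (x₀ : Euc n) {r : ℝ} (hr : 0 < r) {F : Set (Euc n)}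
    (hnear : Tendsto (fun x => ENNReal.ofReal (‖x - x₀‖ ^ (((n : ℝ) - p) / (p - 1))) *
        ∫⁻ t in Ioo 0 (‖x - x₀‖ / 64), wolffDensity n p μ t x * ENNReal.ofReal t⁻¹)
      (𝓝[F \ {x₀}] x₀) (𝓝 0)) :
    Tendsto (fun x => ENNReal.ofReal (‖x - x₀‖ ^ (((n : ℝ) - p) / (p - 1))) *
        wolffPotential n p μ x r) (𝓝[F \ {x₀}] x₀)
      (𝓝 (ENNReal.ofReal ((p - 1) / ((n : ℝ) - p)) * μ {x₀} ^ (1 / (p - 1)))) := by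
  have hα : 0 < 1 / (p - 1) := one_div_pos.2 (by linarith)
  rw [show (p - 1) / ((n : ℝ) - p) = (((n : ℝ) - p) / (p - 1))⁻¹ from (inv_div _ _).symm]
  set β : ℝ := ((n : ℝ) - p) / (p - 1) with hβ'
  have hβ : 0 < β := div_pos (by linarith) (by linarith)
  set α : ℝ := 1 / (p - 1) with hα'
  set l : Filter (Euc n) := 𝓝[F \ {x₀}] x₀ with hl
  have hpos : ∀ᶠ x in l, 0 < ‖x - x₀‖ := by
    filter_upwards [self_mem_nhdsWithin] with x hx
    exact norm_pos_iff.2 (sub_ne_zero.2 hx.2)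
  have hd0 : Tendsto (fun x : Euc n => ‖x - x₀‖) l (𝓝 0) := by
    have h : Continuous fun x : Euc n => ‖x - x₀‖ := by fun_prop
    simpa using (h.tendsto x₀).mono_left nhdsWithin_le_nhds
  have hd : Tendsto (fun x : Euc n => ‖x - x₀‖) l (𝓝[>] 0) :=
    tendsto_nhdsWithin_iff.2 ⟨hd0, hpos⟩
  have hs0 : Tendsto (fun x : Euc n => √‖x - x₀‖) l (𝓝 0) := by
    simpa using hd0.sqrt
  have hs : Tendsto (fun x : Euc n => √‖x - x₀‖) l (𝓝[>] 0) :=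
    tendsto_nhdsWithin_iff.2 ⟨hs0, hpos.mono fun x hx => Real.sqrt_pos.2 hx⟩
  have hzero : ∀ {g : Euc n → ℝ}, Tendsto g l (𝓝 0) →
      Tendsto (fun x => g x ^ β) l (𝓝 0) := fun hg => by
    simpa [Real.zero_rpow hβ.ne'] using hg.rpow_const (p := β) (Or.inr hβ.le)
  have hMα : μ {x₀} ^ α ≠ ⊤ := ENNReal.rpow_ne_top_of_nonneg hα.le (measure_ne_top _ _)
  have hUα : μ univ ^ α ≠ ⊤ := ENNReal.rpow_ne_top_of_nonneg hα.le (measure_ne_top _ _)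
  have hlow : Tendsto (fun x => μ {x₀} ^ α *
      ENNReal.ofReal ((1 - ‖x - x₀‖ ^ β * r ^ (-β)) / β)) l
        (𝓝 (ENNReal.ofReal β⁻¹ * μ {x₀} ^ α)) := by
    have h1 : Tendsto (fun x => (1 - ‖x - x₀‖ ^ β * r ^ (-β)) / β) l (𝓝 β⁻¹) := by
      simpa using (((hzero hd0).mul_const (r ^ (-β))).const_sub 1).div_const β
    rw [mul_comm]
    exact ENNReal.Tendsto.const_mul (ENNReal.tendsto_ofReal h1) (Or.inr hMα)
  have hmid : Tendsto (fun x => μ (ball x₀ (2 * ‖x - x₀‖) \ {x₀}) ^ α *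
      ENNReal.ofReal (64 ^ β / β)) l (𝓝 0) := by
    have h1 := ((tendsto_measure_ball_diff μ x₀).comp hd).ennrpow_const α
    rw [ENNReal.zero_rpow_of_pos hα] at h1
    have h2 := ENNReal.Tendsto.mul_const h1
      (Or.inr (ENNReal.ofReal_ne_top (r := 64 ^ β / β)))
    rwa [zero_mul] at h2
  have hmain : Tendsto (fun x => μ (ball x₀ (2 * √‖x - x₀‖)) ^ α * ENNReal.ofReal β⁻¹) l
      (𝓝 (ENNReal.ofReal β⁻¹ * μ {x₀} ^ α)) := by
    rw [mul_comm]
    exact ENNReal.Tendsto.mul_const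
      (((tendsto_measure_ball_singleton μ x₀).comp hs).ennrpow_const α)
      (Or.inr ENNReal.ofReal_ne_top)
  have hfar : Tendsto (fun x => μ univ ^ α * ENNReal.ofReal (√‖x - x₀‖ ^ β / β)) l (𝓝 0) := by
    have h1 : Tendsto (fun x => √‖x - x₀‖ ^ β / β) l (𝓝 0) := by
      simpa using (hzero hs0).div_const β
    have h2 := ENNReal.Tendsto.const_mul (ENNReal.tendsto_ofReal h1) (Or.inr hUα)
    simpa using h2
  have hup := ((hnear.add hmid).add hmain).add hfar
  rw [add_zero, add_zero, zero_add] at hup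
  refine tendsto_of_tendsto_of_tendsto_of_le_of_le' hlow hup ?_ ?_
  · filter_upwards [hpos, hd0.eventually_le_const hr] with x h1 h2
    exact le_wolffPotential hp₁ hp₂ μ rfl h1 h2
  · filter_upwards [hpos, hd0.eventually_le_const one_pos] with x h1 h2
    exact wolffPotential_le hp₁ hp₂ μ r rfl h1 h2

end Main

/-- let `μ` be a nonnegative finite Radon measure on `Ω ⊆ ℝⁿ` with
`B(x₀, 3r₀) ⊆ Ω` and `p ∈ (1, n)`. Then there is a set `E`, `p`-thin for singular
behavior at `x₀`, with
`lim_{x→x₀, x∉E} |x-x₀|^{(n-p)/(p-1)} W^μ_{1,p}(x, r₀) = ((p-1)/(n-p)) μ({x₀})^{1/(p-1)}`. -/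
theorem wolff_potential_asymptotics (n : ℕ) (p : ℝ) (hp₁ : 1 < p) (hp₂ : p < n)
    (Ω : Set (Euc n)) (μ : Measure (Euc n)) [IsFiniteMeasure μ]
    (x₀ : Euc n) (r₀ : ℝ) (hr₀ : 0 < r₀) (hball : Metric.ball x₀ (3 * r₀) ⊆ Ω) :
    ∃ E : Set (Euc n), pThinAt n p E x₀ ∧
      Tendsto (fun x => ENNReal.ofReal (‖x - x₀‖ ^ (((n : ℝ) - p) / (p - 1))) *
          wolffPotential n p μ x r₀)
        (𝓝[Eᶜ \ {x₀}] x₀)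
        (𝓝 (ENNReal.ofReal ((p - 1) / ((n : ℝ) - p)) * μ {x₀} ^ (1 / (p - 1)))) := by
  obtain ⟨τ, hτ, hsum⟩ :=
    ENNReal.exists_tendsto_atTop_tsum_mul_ne_top _ (tsum_measure_fatAnnulus_ne_top μ x₀)
  exact ⟨exceptionalSet n p μ x₀ τ, pThinAt_exceptionalSet hp₁ hp₂ μ x₀ hsum,
    tendsto_wolffPotential hp₁ hp₂ μ x₀ hr₀ (tendsto_near_part hp₁ hp₂ μ x₀ hτ)⟩
end
end
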